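/- arXiv:2107.13605 — 2 statements merged into one kernel-verified Lean document; each statement's English description precedes it below -/
import Mathlib

section
/- Let p > 0 and let (A_k)_{k≥1} be a sequence of operators in 𝓛_{p,∞} on a complex Hilbert space such that for each k the limit L_k := lim_{j→∞} j^{1/p} μ_j(A_k) exists. Suppose ‖A_k − A‖_{p,∞} → 0 as k → ∞. Then the limit L := lim_{j→∞} j^{1/p} μ_j(A) exists and L_k → L as k → ∞. -/
open Filter MeasureTheory

universe u v

/-- Singular values via the Courant–Fischer / approximation-number formula:
`μ_j(T) = inf { sup { ‖Tξ‖ : ξ ∈ Eᗮ, ‖ξ‖ = 1 } : dim E = j }`. -/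
noncomputable def sv {H : Type u} [NormedAddCommGroup H] [InnerProductSpace ℂ H]
    (T : H →L[ℂ] H) (j : ℕ) : ℝ :=
  ⨅ E : {E : Submodule ℂ H // Module.finrank ℂ E = j},
    ⨆ ξ : {ξ : H // ξ ∈ (E.1)ᗮ ∧ ‖ξ‖ = 1}, ‖T ξ.1‖

/-- Membership in the weak Schatten class `𝓛_{p,∞}`: compactness together with
`sup_j (j+1)^{1/p} μ_j(T) < ∞`. -/
def MemWeak {H : Type u} [NormedAddCommGroup H] [InnerProductSpace ℂ H]
    (p : ℝ) (T : H →L[ℂ] H) : Prop :=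
  IsCompactOperator ⇑T ∧ ∃ C : ℝ, ∀ j : ℕ, ((j : ℝ) + 1) ^ (1 / p) * sv T j ≤ C

/-- The weak Schatten quasi-norm `‖T‖_{p,∞} = sup_{j ≥ 0} (j+1)^{1/p} μ_j(T)`. -/
noncomputable def weakNorm {H : Type u} [NormedAddCommGroup H] [InnerProductSpace ℂ H]
    (p : ℝ) (T : H →L[ℂ] H) : ℝ :=
  ⨆ j : ℕ, ((j : ℝ) + 1) ^ (1 / p) * sv T j

/-- A finite-dimensional subspace extends to one of any larger dimension that is attained by some
finite-dimensional subspace. -/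
lemma Submodule.exists_ge_finrank_eq {K V : Type*} [DivisionRing K] [AddCommGroup V] [Module K V]
    (W : Submodule K V) (G : Submodule K V) [FiniteDimensional K G]
    (h : Module.finrank K G ≤ Module.finrank K W) :
    ∃ G' : Submodule K V, G ≤ G' ∧ Module.finrank K G' = Module.finrank K W := by
  obtain ⟨d, hd⟩ := Nat.exists_eq_add_of_le h
  clear h
  induction d generalizing G with
  | zero => exact ⟨G, le_rfl, by omega⟩
  | succ d ih =>
    have hWG : ¬ W ≤ G := fun hle => by
      have := Submodule.finrank_mono hle
      omega
    obtain ⟨x, -, hxG⟩ := SetLike.not_le_iff_exists.1 hWG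
    have hlt : G < G ⊔ Submodule.span K {x} :=
      lt_of_le_of_ne le_sup_left fun he => hxG <| by
        rw [he]
        exact Submodule.mem_sup_right (Submodule.mem_span_singleton_self x)
    have h1 := Submodule.finrank_lt_finrank_of_lt hlt
    have h2 := Submodule.finrank_add_le_finrank_add_finrank G (Submodule.span K {x})
    have h3 : Module.finrank K (Submodule.span K {x}) ≤ 1 := by
      simpa using finrank_span_le_card (R := K) ({x} : Set V)
    obtain ⟨G', hG', hfin⟩ := ih (G ⊔ Submodule.span K {x}) (by omega)
    exact ⟨G', le_sup_left.trans hG', hfin⟩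

section SingularValues

variable {H : Type u} [NormedAddCommGroup H] [InnerProductSpace ℂ H]

lemma bddAbove_norm_unit_orthogonal (T : H →L[ℂ] H) (E : Submodule ℂ H) :
    BddAbove (Set.range fun ξ : {ξ : H // ξ ∈ Eᗮ ∧ ‖ξ‖ = 1} => ‖T ξ.1‖) := by
  refine ⟨‖T‖, ?_⟩
  rintro _ ⟨ξ, rfl⟩
  simpa [ξ.2.2] using T.le_opNorm ξ.1

lemma bddBelow_sv (T : H →L[ℂ] H) (j : ℕ) :
    BddBelow (Set.range fun E : {E : Submodule ℂ H // Module.finrank ℂ E = j} =>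
      ⨆ ξ : {ξ : H // ξ ∈ (E.1)ᗮ ∧ ‖ξ‖ = 1}, ‖T ξ.1‖) := by
  refine ⟨0, ?_⟩
  rintro _ ⟨E, rfl⟩
  exact Real.iSup_nonneg fun _ => norm_nonneg _

lemma sv_nonneg (T : H →L[ℂ] H) (j : ℕ) : 0 ≤ sv T j :=
  Real.iInf_nonneg fun _ => Real.iSup_nonneg fun _ => norm_nonneg _

lemma sv_neg (T : H →L[ℂ] H) (j : ℕ) : sv (-T) j = sv T j := by
  simp [sv]

/-- Ky Fan's inequality. The indices are positive because `finrank = 0` also holds for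
infinite-dimensional subspaces. -/
lemma sv_add_le (S T : H →L[ℂ] H) {i j : ℕ} (hi : 0 < i) (hj : 0 < j) :
    sv (S + T) (i + j) ≤ sv S i + sv T j := by
  rcases isEmpty_or_nonempty {E : Submodule ℂ H // Module.finrank ℂ E = i + j} with hE | ⟨⟨W, hW⟩⟩
  · have h0 : sv (S + T) (i + j) = 0 := by simp [sv, Real.iInf_of_isEmpty]
    rw [h0]
    exact add_nonneg (sv_nonneg S i) (sv_nonneg T j)
  have : FiniteDimensional ℂ W := Module.finite_of_finrank_pos (by omega)
  have hne : ∀ n, n ≤ i + j → Nonempty {E : Submodule ℂ H // Module.finrank ℂ E = n} := by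
    intro n hn
    obtain ⟨v, hv⟩ := exists_linearIndependent_of_le_finrank (R := ℂ) (M := W) (hn.trans hW.ge)
    have hv' : LinearIndependent ℂ (fun k => (v k : H)) :=
      hv.map' W.subtype W.ker_subtype
    exact ⟨⟨Submodule.span ℂ (Set.range fun k => (v k : H)), by
      simpa using finrank_span_eq_card hv'⟩⟩
  have := hne i (by omega)
  have := hne j (by omega)
  refine le_ciInf_add_ciInf fun E F => ?_
  have : FiniteDimensional ℂ E.1 := Module.finite_of_finrank_pos (by rw [E.2]; exact hi)
  have : FiniteDimensional ℂ F.1 := Module.finite_of_finrank_pos (by rw [F.2]; exact hj)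
  have hle := Submodule.finrank_add_le_finrank_add_finrank E.1 F.1
  rw [E.2, F.2, ← hW] at hle
  obtain ⟨G, hG, hGfin⟩ := Submodule.exists_ge_finrank_eq W (E.1 ⊔ F.1) hle
  refine (ciInf_le (bddBelow_sv (S + T) (i + j)) ⟨G, hGfin.trans hW⟩).trans ?_
  refine Real.iSup_le (fun ξ => ?_) (add_nonneg (Real.iSup_nonneg fun _ => norm_nonneg _)
    (Real.iSup_nonneg fun _ => norm_nonneg _))
  have hξE : ξ.1 ∈ (E.1)ᗮ := Submodule.orthogonal_le (le_sup_left.trans hG) ξ.2.1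
  have hξF : ξ.1 ∈ (F.1)ᗮ := Submodule.orthogonal_le (le_sup_right.trans hG) ξ.2.1
  exact (norm_add_le (S ξ.1) (T ξ.1)).trans <| add_le_add
    (le_ciSup (bddAbove_norm_unit_orthogonal S E.1) ⟨ξ.1, hξE, ξ.2.2⟩)
    (le_ciSup (bddAbove_norm_unit_orthogonal T F.1) ⟨ξ.1, hξF, ξ.2.2⟩)

lemma MemWeak.rpow_mul_sv_le {p : ℝ} {T : H →L[ℂ] H} (h : MemWeak p T) (j : ℕ) :
    ((j : ℝ) + 1) ^ (1 / p) * sv T j ≤ weakNorm p T := by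
  obtain ⟨C, hC⟩ := h.2
  refine le_ciSup (f := fun j : ℕ => ((j : ℝ) + 1) ^ (1 / p) * sv T j) ⟨C, ?_⟩ j
  rintro _ ⟨j, rfl⟩
  exact hC j

/-- Ky Fan's inequality, weighted by powers of the index, at a splitting `n + m` in which `n / m`
is close to `N`. -/
lemma rpow_mul_sv_add_le {α e N : ℝ} (hα : 0 ≤ α) (hN : 0 < N) (S D : H →L[ℂ] H) {n m : ℕ}
    (hn : 0 < n) (hm : 0 < m) (hD : ((m : ℝ) + 1) ^ α * sv D m ≤ e)
    (h1 : N * m ≤ n) (h2 : (n : ℝ) ≤ N * (m + 1)) :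
    ((n + m : ℕ) : ℝ) ^ α * sv (S + D) (n + m) ≤
      (1 + 1 / N) ^ α * ((n : ℝ) ^ α * sv S n + N ^ α * e) := by
  have hc : ((n + m : ℕ) : ℝ) ^ α ≤ (1 + 1 / N) ^ α * (n : ℝ) ^ α := by
    rw [← Real.mul_rpow (by positivity) (by positivity)]
    refine Real.rpow_le_rpow (by positivity) ?_ hα
    have : (m : ℝ) ≤ n / N := by rw [le_div_iff₀ hN]; linarith
    push_cast
    calc (n : ℝ) + m ≤ n + n / N := by linarith
      _ = (1 + 1 / N) * n := by ring
  have hd : (n : ℝ) ^ α * sv D m ≤ N ^ α * e := by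
    have : (n : ℝ) ^ α ≤ N ^ α * ((m : ℝ) + 1) ^ α := by
      rw [← Real.mul_rpow (by positivity) (by positivity)]
      exact Real.rpow_le_rpow (by positivity) h2 hα
    calc (n : ℝ) ^ α * sv D m ≤ N ^ α * ((m : ℝ) + 1) ^ α * sv D m :=
          mul_le_mul_of_nonneg_right this (sv_nonneg D m)
      _ = N ^ α * (((m : ℝ) + 1) ^ α * sv D m) := by ring
      _ ≤ N ^ α * e := mul_le_mul_of_nonneg_left hD (by positivity)
  calc ((n + m : ℕ) : ℝ) ^ α * sv (S + D) (n + m)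
      ≤ (1 + 1 / N) ^ α * (n : ℝ) ^ α * sv (S + D) (n + m) :=
        mul_le_mul_of_nonneg_right hc (sv_nonneg _ _)
    _ ≤ (1 + 1 / N) ^ α * (n : ℝ) ^ α * (sv S n + sv D m) :=
        mul_le_mul_of_nonneg_left (sv_add_le S D hn hm) (by positivity)
    _ = (1 + 1 / N) ^ α * ((n : ℝ) ^ α * sv S n + (n : ℝ) ^ α * sv D m) := by ring
    _ ≤ _ := by gcongr

end SingularValues

/-- If the limits `L k` control the eventual values of `F` from both sides, up to factors `c N`
tending to `1` and errors `w N * ε k` vanishing as `k → ∞`, then `F` and `L` converge to the same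
limit. -/
lemma exists_tendsto_of_eventually_le {F L ε c w : ℕ → ℝ}
    (hε : Tendsto ε atTop (nhds 0))
    (hc : Tendsto c atTop (nhds 1)) (hc1 : ∀ N, 1 ≤ c N) (hw : ∀ N, 0 ≤ w N)
    (upper : ∀ N k, ∀ η > 0, ∀ᶠ n in atTop, F n ≤ c N * (L k + w N * ε k) + η)
    (lower : ∀ N k, ∀ η > 0, ∀ᶠ n in atTop, L k ≤ c N * (F n + w N * ε k) + η) :
    ∃ l : ℝ, Tendsto F atTop (nhds l) ∧ Tendsto L atTop (nhds l) := by
  obtain ⟨B, hB⟩ : ∃ B, ∀ᶠ n in atTop, F n ≤ B := ⟨_, upper 0 0 1 one_pos⟩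
  obtain ⟨E, hE⟩ := hε.bddAbove_range
  have hE k : ε k ≤ E := hE ⟨k, rfl⟩
  obtain ⟨M, hM⟩ : ∃ M, ∀ k, L k ≤ M := by
    refine ⟨c 0 * (B + w 0 * E) + 1, fun k => ?_⟩
    obtain ⟨n, h1, h2⟩ := (hB.and (lower 0 k 1 one_pos)).exists
    refine h2.trans ?_
    have := hw 0
    have := hc1 0
    have := hE k
    gcongr
  have close : ∀ η > 0, ∃ K, ∀ k ≥ K, ∀ᶠ n in atTop, |F n - L k| ≤ η := by
    intro η hη
    have hlim : Tendsto (fun N => (c N - 1) * max M B) atTop (nhds 0) := by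
      simpa using (hc.sub_const 1).mul_const (max M B)
    obtain ⟨N, hN⟩ := (hlim.eventually_lt_const (show (0 : ℝ) < η / 4 by positivity)).exists
    have hlim' : Tendsto (fun k => c N * (w N * ε k)) atTop (nhds 0) := by
      simpa using (hε.const_mul (w N)).const_mul (c N)
    obtain ⟨K, hK⟩ := eventually_atTop.1
      (hlim'.eventually_lt_const (show (0 : ℝ) < η / 4 by positivity))
    refine ⟨K, fun k hk => ?_⟩
    filter_upwards [hB, upper N k (η / 4) (by positivity), lower N k (η / 4) (by positivity)]
      with n h1 h2 h3
    have hkk := hK k hk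
    have hcN : 0 ≤ c N - 1 := sub_nonneg.2 (hc1 N)
    have h4 := mul_le_mul_of_nonneg_left ((hM k).trans (le_max_left M B)) hcN
    have h5 := mul_le_mul_of_nonneg_left (h1.trans (le_max_right M B)) hcN
    rw [abs_le]
    constructor <;> linarith
  have hcauchy : CauchySeq L := by
    refine Metric.cauchySeq_iff.2 fun η hη => ?_
    obtain ⟨K, hK⟩ := close (η / 3) (by positivity)
    refine ⟨K, fun i hi j hj => ?_⟩
    obtain ⟨n, h1, h2⟩ := ((hK i hi).and (hK j hj)).exists
    rw [Real.dist_eq, abs_lt]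
    rw [abs_le] at h1 h2
    constructor <;> linarith
  obtain ⟨l, hl⟩ := cauchySeq_tendsto_of_complete hcauchy
  refine ⟨l, Metric.tendsto_atTop'.2 fun η hη => ?_, hl⟩
  obtain ⟨K, hK⟩ := close (η / 3) (by positivity)
  obtain ⟨K', hK'⟩ := Metric.tendsto_atTop.1 hl (η / 3) (by positivity)
  have h1 := hK' (max K K') (le_max_right _ _)
  obtain ⟨n₀, hn₀⟩ := eventually_atTop.1 (hK (max K K') (le_max_left _ _))
  refine ⟨n₀, fun n hn => ?_⟩
  have h2 := hn₀ n hn.le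
  rw [Real.dist_eq, abs_lt] at *
  rw [abs_le] at h2
  constructor <;> linarith

/-- If `A_k ∈ 𝓛_{p,∞}` have existing limits `L_k = lim_j j^{1/p} μ_j(A_k)` and
`‖A_k - A‖_{p,∞} → 0`, then `L = lim_j j^{1/p} μ_j(A)` exists and `L_k → L`. -/
theorem weylLimits_sing_closed {H : Type u} [NormedAddCommGroup H] [InnerProductSpace ℂ H]
    [CompleteSpace H] (p : ℝ) (hp : 0 < p)
    (A : ℕ → H →L[ℂ] H) (hmem : ∀ k, MemWeak p (A k))
    (L : ℕ → ℝ)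
    (hL : ∀ k, Tendsto (fun j : ℕ => (j : ℝ) ^ (1 / p) * sv (A k) j) atTop (nhds (L k)))
    (A₀ : H →L[ℂ] H)
    (hdiff : ∀ k, MemWeak p (A k - A₀))
    (hconv : Tendsto (fun k => weakNorm p (A k - A₀)) atTop (nhds 0)) :
    ∃ l : ℝ, Tendsto (fun j : ℕ => (j : ℝ) ^ (1 / p) * sv A₀ j) atTop (nhds l) ∧
      Tendsto L atTop (nhds l) := by
  have hα : 0 ≤ 1 / p := by positivity
  set α := 1 / p
  have hbound k (m : ℕ) : ((m : ℝ) + 1) ^ α * sv (A k - A₀) m ≤ weakNorm p (A k - A₀) :=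
    (hdiff k).rpow_mul_sv_le m
  have hbound' k (m : ℕ) : ((m : ℝ) + 1) ^ α * sv (A₀ - A k) m ≤ weakNorm p (A k - A₀) := by
    rw [← neg_sub, sv_neg]
    exact hbound k m
  refine exists_tendsto_of_eventually_le (ε := fun k => weakNorm p (A k - A₀))
    (c := fun N => (1 + 1 / ((N : ℝ) + 1)) ^ α) (w := fun N => ((N : ℝ) + 1) ^ α)
    hconv ?_ (fun N => Real.one_le_rpow ?_ hα)
    (fun N => by positivity) ?_ ?_
  · have h := (tendsto_one_div_add_atTop_nhds_zero_nat (𝕜 := ℝ)).const_add 1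
    simpa using h.rpow_const (p := α) (Or.inr hα)
  · have : (0 : ℝ) ≤ 1 / ((N : ℝ) + 1) := by positivity
    linarith
  · intro N k η hη
    have hsub : Tendsto (fun j : ℕ => j - j / (N + 2)) atTop atTop := by
      refine tendsto_atTop_mono (f := fun j => j / 2) (fun j => ?_)
        (Nat.tendsto_div_const_atTop two_ne_zero)
      have := Nat.div_le_div_left (show 2 ≤ N + 2 by omega) two_pos (a := j)
      change j / 2 ≤ j - j / (N + 2)
      omega
    have hlim := ((((hL k).comp hsub).add_const (((N : ℝ) + 1) ^ α * weakNorm p (A k - A₀))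
      ).const_mul ((1 + 1 / ((N : ℝ) + 1)) ^ α))
    filter_upwards [hlim.eventually_le_const (lt_add_of_pos_right _ hη),
      eventually_ge_atTop (N + 2)] with j hj hjN
    refine le_trans ?_ hj
    have hm : 0 < j / (N + 2) := Nat.div_pos hjN (by omega)
    have e1 := Nat.div_add_mod j (N + 2)
    have e2 := Nat.mod_lt j (show 0 < N + 2 by omega)
    set m := j / (N + 2) with hmdef
    obtain ⟨n, hn⟩ : ∃ n, j = n + m := ⟨j - m, (Nat.sub_add_cancel (Nat.div_le_self _ _)).symm⟩
    have e3 : (N + 2) * m = (N + 1) * m + m := by ring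
    have h1 : (N + 1) * m ≤ n := by omega
    have h2 : n ≤ (N + 1) * (m + 1) := by
      rw [mul_add_one]
      omega
    have hn0 : 0 < n := lt_of_lt_of_le (by positivity) h1
    have hjm : j - m = n := by omega
    have key := rpow_mul_sv_add_le hα (N := (N : ℝ) + 1) (by positivity) (A k) (A₀ - A k) hn0 hm
      (hbound' k m) (by exact_mod_cast h1) (by exact_mod_cast h2)
    rw [add_sub_cancel, ← hn] at key
    simpa only [Function.comp_apply, ← hmdef, hjm] using key
  · intro N k η hη
    have hadd : Tendsto (fun n : ℕ => n + n / (N + 1)) atTop atTop :=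
      tendsto_atTop_mono (fun n => Nat.le_add_right n _) tendsto_id
    filter_upwards [((hL k).comp hadd).eventually_const_le (sub_lt_self (L k) hη),
      eventually_ge_atTop (N + 1)] with n hn hnN
    have hm : 0 < n / (N + 1) := Nat.div_pos hnN (by omega)
    have e1 := Nat.div_add_mod n (N + 1)
    have e2 := Nat.mod_lt n (show 0 < N + 1 by omega)
    simp only [Function.comp_apply] at hn
    set m := n / (N + 1)
    have h1 : (N + 1) * m ≤ n := by omega
    have h2 : n ≤ (N + 1) * (m + 1) := by nlinarith
    have key := rpow_mul_sv_add_le hα (N := (N : ℝ) + 1) (by positivity) A₀ (A k - A₀)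
      (show 0 < n by omega) hm (hbound k m) (by exact_mod_cast h1) (by exact_mod_cast h2)
    rw [add_sub_cancel] at key
    linarith
end

section
/- Let A ∈ Com(𝓛_{1,∞}) on a separable complex Hilbert space, and let (λ_j(A))_{j≥0} be an eigenvalue sequence of A. Then sup_{N≥1} | ∑_{j<N} λ_j(A) | < ∞. -/
open Filter MeasureTheory

universe u v

/-- The commutator subspace `Com(𝓛_{1,∞})`: the linear span of commutators `[B, T] = BT - TB`
with `B` bounded and `T ∈ 𝓛_{1,∞}`. -/
def ComL1inf (H : Type u) [NormedAddCommGroup H] [InnerProductSpace ℂ H] :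
    Submodule ℂ (H →L[ℂ] H) :=
  Submodule.span ℂ {T | ∃ B S : H →L[ℂ] H, MemWeak 1 S ∧ T = B * S - S * B}

/-- Algebraic multiplicity of `z` as an eigenvalue of `A`:
the dimension of `⋃_{ℓ ≥ 1} ker (A - z)^ℓ`. -/
noncomputable def algMult {H : Type u} [NormedAddCommGroup H] [InnerProductSpace ℂ H]
    (A : H →L[ℂ] H) (z : ℂ) : Cardinal.{u} :=
  Module.rank ℂ
    ↥(⨆ ℓ : ℕ, LinearMap.ker (((A : H →ₗ[ℂ] H) - z • LinearMap.id) ^ ℓ))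

/-- `lam` is an eigenvalue sequence of `A`: the moduli `‖lam j‖` are nonincreasing and every
nonzero `z ∈ ℂ` occurs in `lam` exactly `algMult A z` times (so the nonzero eigenvalues are
listed with algebraic multiplicity in order of decreasing modulus, padded with zeros). -/
def IsEigenvalueSequence {H : Type u} [NormedAddCommGroup H] [InnerProductSpace ℂ H]
    (A : H →L[ℂ] H) (lam : ℕ → ℂ) : Prop :=
  (∀ j, ‖lam (j + 1)‖ ≤ ‖lam j‖) ∧
  ∀ z : ℂ, z ≠ 0 →
    Cardinal.lift.{u} (Cardinal.mk {j : ℕ // lam j = z}) = Cardinal.lift.{0} (algMult A z)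

/-- A Borel–Carathéodory bound for the derivative at the centre of a zero-free function. -/
theorem norm_deriv_zero_le_of_ne_zero {D : ℂ → ℂ} {ρ M : ℝ} (hρ : 0 < ρ) (hM : 0 < M)
    (hD : DifferentiableOn ℂ D (Metric.ball 0 ρ)) (hD0 : D 0 = 1)
    (hne : ∀ z ∈ Metric.ball (0 : ℂ) ρ, D z ≠ 0)
    (hle : ∀ z ∈ Metric.ball (0 : ℂ) ρ, ‖D z‖ ≤ Real.exp M) :
    ‖deriv D 0‖ ≤ 4 * M / ρ := by
  have h0 : (0 : ℂ) ∈ Metric.ball (0 : ℂ) ρ := Metric.mem_ball_self hρ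
  have hd : DifferentiableOn ℂ (fun z => deriv D z / D z) (Metric.ball 0 ρ) :=
    (hD.deriv Metric.isOpen_ball).div hD hne
  obtain ⟨h, hh0, hh⟩ := hd.isExactOn_ball.with_val_at 0 0
  have hDd : ∀ z ∈ Metric.ball (0 : ℂ) ρ, HasDerivAt D (deriv D z) z := fun z hz =>
    (hD.differentiableAt (Metric.isOpen_ball.mem_nhds hz)).hasDerivAt
  have hq : ∀ z ∈ Metric.ball (0 : ℂ) ρ,
      HasDerivAt (fun z => Complex.exp (-h z) * D z) 0 z := by
    intro z hz
    have := ((hh z hz).neg.cexp).mul (hDd z hz)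
    refine this.congr_deriv ?_
    have := hne z hz
    simp only [Pi.neg_apply]
    field_simp
    ring
  have hconst : ∀ z ∈ Metric.ball (0 : ℂ) ρ, Complex.exp (-h z) * D z = 1 := by
    intro z hz
    have := Metric.isOpen_ball.is_const_of_deriv_eq_zero
      (convex_ball (0 : ℂ) ρ).isPreconnected
      (fun z hz => (hq z hz).differentiableAt.differentiableWithinAt)
      (fun z hz => (hq z hz).deriv) hz h0
    simpa [hh0, hD0] using this
  have hexp : ∀ z ∈ Metric.ball (0 : ℂ) ρ, D z = Complex.exp (h z) := by
    intro z hz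
    have := hconst z hz
    rw [Complex.exp_neg] at this
    have h2 := Complex.exp_ne_zero (h z)
    field_simp at this
    exact this
  have hdiff : DifferentiableOn ℂ h (Metric.ball 0 ρ) := fun z hz =>
    (hh z hz).differentiableAt.differentiableWithinAt
  have hre : Set.MapsTo h (Metric.ball 0 ρ) {z | z.re ≤ M} := by
    intro z hz
    have := hle z hz
    rw [hexp z hz, Complex.norm_exp] at this
    exact Real.exp_le_exp.1 this
  have hder : HasDerivAt h (deriv D 0) 0 := by simpa [hD0] using hh 0 h0
  refine hder.le_of_lip' (by positivity) ?_
  filter_upwards [Metric.ball_mem_nhds (0 : ℂ) (half_pos hρ)] with z hz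
  have hz' : ‖z‖ < ρ / 2 := by simpa using hz
  have hb := Complex.borelCaratheodory_zero hM hdiff hre hρ
    (show z ∈ Metric.ball 0 ρ by simp; linarith) hh0
  simp only [hh0, sub_zero]
  refine hb.trans ?_
  rw [div_le_iff₀ (by linarith)]
  have : 4 * M / ρ * ‖z‖ * (ρ - ‖z‖) = 4 * M * ‖z‖ * ((ρ - ‖z‖) / ρ) := by ring
  rw [this]
  have h2 : 1 / 2 ≤ (ρ - ‖z‖) / ρ := by rw [le_div_iff₀ hρ]; linarith
  have h3 : 0 ≤ 4 * M * ‖z‖ := by positivity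
  nlinarith

/-- **Hadamard's inequality** for the determinant of an endomorphism. -/
theorem norm_det_le_prod_norm {V : Type*} [NormedAddCommGroup V] [InnerProductSpace ℂ V] {m : ℕ}
    (b : OrthonormalBasis (Fin m) ℂ V) (f : V →ₗ[ℂ] V) :
    ‖LinearMap.det f‖ ≤ ∏ i, ‖f (b i)‖ := by
  have : FiniteDimensional ℂ V := b.toBasis.finiteDimensional_of_finite
  have hcard : Module.finrank ℂ V = Fintype.card (Fin m) := Module.finrank_eq_card_basis b.toBasis
  set c := InnerProductSpace.gramSchmidtOrthonormalBasis hcard (f ∘ b) with hc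
  have h1 : LinearMap.det f = b.toBasis.det (f ∘ b) := by
    have := b.toBasis.det_comp f b.toBasis
    rw [b.toBasis.det_self, mul_one] at this
    rw [← this, b.coe_toBasis]
  have h2 : b.toBasis.det (f ∘ b) = b.toBasis.det c * c.toBasis.det (f ∘ b) := by
    have := b.toBasis.det.eq_smul_basis_det c.toBasis
    conv_lhs => rw [this]
    simp
  rw [h1, h2, norm_mul, b.det_to_matrix_orthonormalBasis, one_mul, hc,
    InnerProductSpace.gramSchmidtOrthonormalBasis_det, norm_prod]
  refine Finset.prod_le_prod (fun _ _ => norm_nonneg _) fun i _ => ?_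
  refine (norm_inner_le_norm _ _).trans ?_
  rw [OrthonormalBasis.norm_eq_one, one_mul]
  rfl

/-- The determinant has derivative `-tr (M 0)` at the origin along `z ↦ 1 - z M(z)`. -/
theorem hasDerivAt_det_one_sub_smul {ι : Type*} [Fintype ι] [DecidableEq ι]
    {M : ℂ → Matrix ι ι ℂ} (hM : ∀ i j, ContinuousAt (fun z => M z i j) 0) :
    HasDerivAt (fun z => (1 - z • M z).det) (-(M 0).trace) 0 := by
  set F : (ι → ι → ℂ) → ℂ := fun N => (Matrix.of N).det with hF
  have hdet : Differentiable ℂ F := by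
    simp only [hF, Matrix.det_apply, Matrix.of_apply]
    fun_prop
  have key : ∀ N : ℂ → Matrix ι ι ℂ, (∀ i j, ContinuousAt (fun z => N z i j) 0) →
      HasDerivAt (fun z => (1 - z • N z).det)
        (fderiv ℂ F (fun i j => (1 : Matrix ι ι ℂ) i j) (fun i j => -(N 0 i j))) 0 := by
    intro N hN
    have h1 : HasDerivAt (fun z i j => (1 : Matrix ι ι ℂ) i j - z * N z i j)
        (fun i j => -(N 0 i j)) 0 := by
      rw [hasDerivAt_pi]
      intro i
      rw [hasDerivAt_pi]
      intro j
      have : HasDerivAt (fun z => z * N z i j) (N 0 i j) 0 := by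
        rw [hasDerivAt_iff_tendsto_slope]
        refine ((hN i j).tendsto.mono_left nhdsWithin_le_nhds).congr' ?_
        filter_upwards [self_mem_nhdsWithin] with z hz
        have : z ≠ 0 := hz
        simp [slope, this]
      exact this.const_sub ((1 : Matrix ι ι ℂ) i j)
    have h2 : HasFDerivAt F (fderiv ℂ F (fun i j => (1 : Matrix ι ι ℂ) i j))
        ((fun z i j => (1 : Matrix ι ι ℂ) i j - z * N z i j) (0 : ℂ)) := by
      simpa using (hdet (fun i j => (1 : Matrix ι ι ℂ) i j)).hasFDerivAt
    exact h2.comp_hasDerivAt (0 : ℂ) h1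
  have h1 := key M hM
  have h2 := key (fun _ => M 0) fun _ _ => continuousAt_const
  have h3 : HasDerivAt (fun z : ℂ => (1 - z • M 0).det) (-(M 0).trace) 0 := by
    have : (fun z : ℂ => (1 - z • M 0).det) = fun z : ℂ =>
        1 + (-M 0).trace * z + ((1 + (Polynomial.X : Polynomial ℂ) •
          (-M 0).map Polynomial.C).det).divX.divX.eval z * z ^ 2 := by
      funext z
      rw [← Matrix.det_one_add_smul, smul_neg, sub_eq_add_neg]
    rw [this]
    have hp := (((1 + (Polynomial.X : Polynomial ℂ) •
          (-M 0).map Polynomial.C).det).divX.divX.hasDerivAt 0).mul ((hasDerivAt_id (0:ℂ)).pow 2)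
    have := (((hasDerivAt_id (0:ℂ)).const_mul (-M 0).trace).const_add 1).add hp
    refine this.congr_deriv ?_
    simp
  rwa [← h2.unique h3]

section Approximation

variable {H : Type u} [NormedAddCommGroup H] [InnerProductSpace ℂ H]

theorem exists_norm_le_of_memWeak_one {S : H →L[ℂ] H} (hS : MemWeak 1 S) :
    ∃ C : ℝ, 0 < C ∧ ∀ n : ℕ, 1 ≤ n → ∃ F : Submodule ℂ H, FiniteDimensional ℂ F ∧
      Module.finrank ℂ F ≤ n ∧ ∀ ξ ∈ Fᗮ, ‖S ξ‖ ≤ C / n * ‖ξ‖ := by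
  obtain ⟨-, C, hC⟩ := hS
  refine ⟨|C| + 1, by positivity, fun n hn => ?_⟩
  have hn0 : (0 : ℝ) < n := by exact_mod_cast hn
  by_cases hr : (n : Cardinal) ≤ Module.rank ℂ H
  · obtain ⟨f, hf⟩ := Module.le_rank_iff_exists_linearMap.1 hr
    have hfr : Module.finrank ℂ (LinearMap.range f) = n := by
      rw [LinearMap.finrank_range_of_inj hf]; simp
    have : Nonempty {E : Submodule ℂ H // Module.finrank ℂ E = n} := ⟨⟨_, hfr⟩⟩
    have hlt : sv S n < (|C| + 1) / n := by
      have h1 := hC n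
      simp only [div_one, Real.rpow_one] at h1
      rw [lt_div_iff₀ hn0]
      by_cases hs : 0 ≤ sv S n
      · nlinarith [le_abs_self C]
      · nlinarith [abs_nonneg C]
    obtain ⟨⟨E, hE⟩, hEC⟩ := exists_lt_of_ciInf_lt hlt
    refine ⟨E, Module.finite_of_finrank_pos (by omega), hE.le, fun ξ hξ => ?_⟩
    rcases eq_or_ne ξ 0 with rfl | h0
    · simp
    have hn' : ‖ξ‖ ≠ 0 := norm_ne_zero_iff.2 h0
    have hbdd : BddAbove (Set.range fun η : {η : H // η ∈ Eᗮ ∧ ‖η‖ = 1} => ‖S η.1‖) := by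
      refine ⟨‖S‖, ?_⟩
      rintro _ ⟨η, rfl⟩
      simpa [η.2.2] using S.le_opNorm η.1
    have hle := le_ciSup hbdd ⟨((‖ξ‖⁻¹ : ℝ) : ℂ) • ξ, Submodule.smul_mem _ _ hξ, by
      simp [norm_smul, hn']⟩
    have hle' := hle.trans hEC.le
    simp only [map_smul, norm_smul, Complex.norm_real, norm_inv, norm_norm] at hle'
    rwa [inv_mul_le_iff₀ (by positivity), mul_comm] at hle'
  · have hlt := not_le.1 hr
    have hfin : FiniteDimensional ℂ H :=
      Module.rank_lt_aleph0_iff.1 (hlt.trans (Cardinal.natCast_lt_aleph0))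
    refine ⟨⊤, inferInstance, ?_, fun ξ hξ => ?_⟩
    · rw [finrank_top]
      rw [← Module.finrank_eq_rank] at hlt
      exact_mod_cast hlt.le
    · rw [Submodule.top_orthogonal_eq_bot, Submodule.mem_bot] at hξ
      simp [hξ]

/-- For every `n ≥ 1`, `A` is within `O(1/n)` in norm of an operator `G ∘ J` of rank `O(n)` and
trace zero. -/
def HasTracelessApprox (A : H →L[ℂ] H) : Prop :=
  ∃ C : ℝ, 0 < C ∧ ∀ n : ℕ, 1 ≤ n →
    ∃ (W : Type u) (_ : NormedAddCommGroup W) (_ : NormedSpace ℂ W) (_ : FiniteDimensional ℂ W)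
      (J : H →L[ℂ] W) (G : W →L[ℂ] H), (Module.finrank ℂ W : ℝ) ≤ C * n ∧
      LinearMap.trace ℂ W (J ∘L G : W →L[ℂ] W) = 0 ∧ ‖A - G ∘L J‖ ≤ C / n

theorem trace_prod_comp_coprod {V W₁ W₂ : Type*} [AddCommGroup V] [Module ℂ V]
    [AddCommGroup W₁] [Module ℂ W₁] [FiniteDimensional ℂ W₁]
    [AddCommGroup W₂] [Module ℂ W₂] [FiniteDimensional ℂ W₂]
    (J₁ : V →ₗ[ℂ] W₁) (J₂ : V →ₗ[ℂ] W₂) (G₁ : W₁ →ₗ[ℂ] V) (G₂ : W₂ →ₗ[ℂ] V) :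
    LinearMap.trace ℂ (W₁ × W₂) ((J₁.prod J₂) ∘ₗ (G₁.coprod G₂)) =
      LinearMap.trace ℂ W₁ (J₁ ∘ₗ G₁) + LinearMap.trace ℂ W₂ (J₂ ∘ₗ G₂) := by
  have h : (J₁.prod J₂) ∘ₗ (G₁.coprod G₂) =
      ((J₁.prod J₂) ∘ₗ G₁) ∘ₗ LinearMap.fst ℂ W₁ W₂ +
        ((J₁.prod J₂) ∘ₗ G₂) ∘ₗ LinearMap.snd ℂ W₁ W₂ := by
    ext <;> simp
  rw [h, map_add, LinearMap.trace_comp_comm' (LinearMap.fst ℂ W₁ W₂),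
    LinearMap.trace_comp_comm' (LinearMap.snd ℂ W₁ W₂)]
  rfl

theorem HasTracelessApprox.zero : HasTracelessApprox (0 : H →L[ℂ] H) := by
  refine ⟨1, one_pos, fun n hn =>
    ⟨PUnit.{u+1}, inferInstance, inferInstance, inferInstance, 0, 0, ?_, ?_, ?_⟩⟩
  · rw [Module.finrank_zero_of_subsingleton]
    simp
  · simp
  · simp

theorem HasTracelessApprox.add {A B : H →L[ℂ] H} (hA : HasTracelessApprox A)
    (hB : HasTracelessApprox B) : HasTracelessApprox (A + B) := by
  obtain ⟨C₁, h₁, hA⟩ := hA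
  obtain ⟨C₂, h₂, hB⟩ := hB
  refine ⟨C₁ + C₂, by positivity, fun n hn => ?_⟩
  obtain ⟨W₁, _, _, _, J₁, G₁, r₁, t₁, e₁⟩ := hA n hn
  obtain ⟨W₂, _, _, _, J₂, G₂, r₂, t₂, e₂⟩ := hB n hn
  refine ⟨W₁ × W₂, inferInstance, inferInstance, inferInstance, J₁.prod J₂, G₁.coprod G₂,
    ?_, ?_, ?_⟩
  · rw [Module.finrank_prod]; push_cast; linarith
  · have := trace_prod_comp_coprod (J₁ : H →ₗ[ℂ] W₁) (J₂ : H →ₗ[ℂ] W₂)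
      (G₁ : W₁ →ₗ[ℂ] H) (G₂ : W₂ →ₗ[ℂ] H)
    refine Eq.trans ?_ (this.trans ((congrArg₂ _ t₁ t₂).trans (add_zero 0)))
    rfl
  · have : A + B - (G₁.coprod G₂) ∘L (J₁.prod J₂) = (A - G₁ ∘L J₁) + (B - G₂ ∘L J₂) := by
      ext ξ; simp; abel
    rw [this, add_div]
    exact (norm_add_le _ _).trans (add_le_add e₁ e₂)

theorem HasTracelessApprox.smul {A : H →L[ℂ] H} (c : ℂ) (hA : HasTracelessApprox A) :
    HasTracelessApprox (c • A) := by
  obtain ⟨C, hC, hA⟩ := hA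
  refine ⟨(‖c‖ + 1) * C, by positivity, fun n hn => ?_⟩
  have hn0 : (0 : ℝ) < n := by exact_mod_cast hn
  obtain ⟨W, _, _, _, J, G, r, t, e⟩ := hA n hn
  refine ⟨W, inferInstance, inferInstance, inferInstance, J, c • G, ?_, ?_, ?_⟩
  · refine r.trans ?_
    have : 0 ≤ ‖c‖ * (C * n) := by positivity
    linarith
  · rw [ContinuousLinearMap.comp_smul, ContinuousLinearMap.toLinearMap_smul, map_smul, t,
      smul_zero]
  · rw [ContinuousLinearMap.smul_comp, ← smul_sub, norm_smul, mul_div_assoc]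
    exact mul_le_mul (by linarith) e (norm_nonneg _) (by positivity)

theorem HasTracelessApprox.commutator (B : H →L[ℂ] H) {S : H →L[ℂ] H} (hS : MemWeak 1 S) :
    HasTracelessApprox (B * S - S * B) := by
  obtain ⟨C, hC, hS⟩ := exists_norm_le_of_memWeak_one hS
  refine ⟨2 + 2 * ‖B‖ * C, by positivity, fun n hn => ?_⟩
  have hn0 : (0 : ℝ) < n := by exact_mod_cast hn
  obtain ⟨F, hFd, hFn, hF⟩ := hS n hn
  set P := F.orthogonalProjectionOnto
  have hR : ‖S - (S ∘L F.subtypeL) ∘L P‖ ≤ C / n := by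
    refine ContinuousLinearMap.opNorm_le_bound _ (by positivity) fun ξ => ?_
    have h1 := hF _ (F.sub_starProjection_mem_orthogonal ξ)
    have h2 : ‖ξ - F.starProjection ξ‖ ≤ ‖ξ‖ := by
      rw [← F.starProjection_orthogonal_val]
      exact Submodule.norm_starProjection_apply_le _ _
    have h3 : (S - (S ∘L F.subtypeL) ∘L P) ξ = S (ξ - F.starProjection ξ) := by
      rw [map_sub]; rfl
    rw [h3]
    exact h1.trans (by gcongr)
  refine ⟨F × F, inferInstance, inferInstance, inferInstance, P.prod (P ∘L B),
    (B ∘L S ∘L F.subtypeL).coprod (-(S ∘L F.subtypeL)), ?_, ?_, ?_⟩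
  · rw [Module.finrank_prod]
    have : (Module.finrank ℂ F : ℝ) ≤ n := by exact_mod_cast hFn
    have h2 : 0 ≤ 2 * ‖B‖ * C * n := by positivity
    push_cast
    linarith
  · have := trace_prod_comp_coprod (P : H →ₗ[ℂ] F)
      ((P ∘L B : H →L[ℂ] F) : H →ₗ[ℂ] F) ((B ∘L S ∘L F.subtypeL : F →L[ℂ] H) : F →ₗ[ℂ] H)
      ((-(S ∘L F.subtypeL) : F →L[ℂ] H) : F →ₗ[ℂ] H)
    refine Eq.trans (by rfl) (this.trans ?_)
    rw [ContinuousLinearMap.toLinearMap_neg, LinearMap.comp_neg, map_neg]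
    exact add_neg_cancel _
  · have : B * S - S * B - ((B ∘L S ∘L F.subtypeL).coprod (-(S ∘L F.subtypeL))) ∘L
        (P.prod (P ∘L B)) =
        B * (S - (S ∘L F.subtypeL) ∘L P) - (S - (S ∘L F.subtypeL) ∘L P) * B := by
      ext ξ; simp; abel
    rw [this]
    calc _ ≤ ‖B‖ * (C / n) + (C / n) * ‖B‖ := by
          refine (norm_sub_le _ _).trans (add_le_add ?_ ?_)
          · exact (norm_mul_le _ _).trans (by gcongr)
          · exact (norm_mul_le _ _).trans (by gcongr)
      _ = (2 * ‖B‖ * C) / n := by ring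
      _ ≤ _ := by gcongr; linarith

theorem HasTracelessApprox.of_mem_comL1inf {A : H →L[ℂ] H} (hA : A ∈ ComL1inf H) :
    HasTracelessApprox A := by
  induction hA using Submodule.span_induction with
  | mem x hx =>
    obtain ⟨B, S, hS, rfl⟩ := hx
    exact .commutator B hS
  | zero => exact .zero
  | add x y _ _ hx hy => exact hx.add hy
  | smul a x _ hx => exact hx.smul a

/-- The space through which the approximants factor can be taken to be a subspace of `H`. -/
theorem HasTracelessApprox.exists_submodule [CompleteSpace H] {A : H →L[ℂ] H}
    (hA : HasTracelessApprox A) :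
    ∃ C : ℝ, 0 < C ∧ ∀ n : ℕ, 1 ≤ n → ∃ (V : Submodule ℂ H) (_ : FiniteDimensional ℂ V)
      (G : V →L[ℂ] H), (Module.finrank ℂ V : ℝ) ≤ C * n ∧
      LinearMap.trace ℂ V (V.orthogonalProjectionOnto ∘L G : V →L[ℂ] V) = 0 ∧
      ‖A - G ∘L V.orthogonalProjectionOnto‖ ≤ C / n := by
  obtain ⟨C, hC, hA⟩ := hA
  refine ⟨C, hC, fun n hn => ?_⟩
  obtain ⟨W, _, _, _, J, G, r, t, e⟩ := hA n hn
  set V : Submodule ℂ H := (LinearMap.ker (J : H →ₗ[ℂ] W))ᗮ with hV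
  have hker : IsClosed ((LinearMap.ker (J : H →ₗ[ℂ] W) : Submodule ℂ H) : Set H) :=
    J.isClosed_ker
  have hVo : Vᗮ = LinearMap.ker (J : H →ₗ[ℂ] W) := by
    rw [hV, Submodule.orthogonal_orthogonal_eq_closure]
    exact hker.submodule_topologicalClosure_eq
  have hinj : Function.Injective ((J : H →ₗ[ℂ] W) ∘ₗ V.subtype) := by
    rw [← LinearMap.ker_eq_bot, LinearMap.ker_eq_bot']
    intro v hv
    have h1 : (v : H) ∈ Vᗮ := by rw [hVo]; exact hv
    have := (Submodule.isOrtho_iff_inner_eq.1 V.isOrtho_orthogonal_right) _ v.2 _ h1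
    exact Subtype.ext (inner_self_eq_zero.1 this)
  have hfin : FiniteDimensional ℂ V := FiniteDimensional.of_injective _ hinj
  have hJ : ∀ ξ, J (V.starProjection ξ) = J ξ := by
    intro ξ
    have h1 := V.sub_starProjection_mem_orthogonal ξ
    rw [hVo, LinearMap.mem_ker] at h1
    have h2 : J (ξ - V.starProjection ξ) = 0 := h1
    rw [map_sub, sub_eq_zero] at h2
    exact h2.symm
  refine ⟨V, hfin, G ∘L J ∘L V.subtypeL, ?_, ?_, ?_⟩
  · exact le_trans (by exact_mod_cast LinearMap.finrank_le_finrank_of_injective hinj) r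
  · rw [← t]
    have h1 := LinearMap.trace_comp_comm' (R := ℂ)
      ((V.orthogonalProjectionOnto ∘L G : W →L[ℂ] V) : W →ₗ[ℂ] V)
      ((J : H →ₗ[ℂ] W) ∘ₗ V.subtype)
    refine Eq.trans (by rfl) (h1.symm.trans ?_)
    congr 1
    ext w
    exact hJ (G w)
  · convert e using 2
    ext ξ
    exact congrArg (fun x => A ξ - G x) (hJ ξ)

/-- On the orthogonal complement of a subspace of dimension at most `j`, `A` is `O(1/(j+1))`. -/
def HasLinearDecay (A : H →L[ℂ] H) : Prop :=
  ∃ C : ℝ, 0 < C ∧ ∀ j : ℕ, ∃ F : Submodule ℂ H, FiniteDimensional ℂ F ∧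
    Module.finrank ℂ F ≤ j ∧ ∀ ξ ∈ Fᗮ, ‖A ξ‖ ≤ C / (j + 1) * ‖ξ‖

theorem HasTracelessApprox.hasLinearDecay [CompleteSpace H] {A : H →L[ℂ] H}
    (hA : HasTracelessApprox A) : HasLinearDecay A := by
  obtain ⟨C, hC, hA⟩ := hA.exists_submodule
  refine ⟨C * (2 * C + 1) + ‖A‖ * (C + 1), by positivity, fun j => ?_⟩
  have hj : (0 : ℝ) < j + 1 := by positivity
  rcases Nat.eq_zero_or_pos ⌊j / C⌋₊ with h0 | hpos
  · refine ⟨⊥, inferInstance, by simp, fun ξ _ => (A.le_opNorm ξ).trans ?_⟩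
    gcongr
    rw [Nat.floor_eq_zero, div_lt_one hC] at h0
    rw [le_div_iff₀ hj]
    have h1 : ‖A‖ * (j + 1) ≤ ‖A‖ * (C + 1) := by gcongr
    have h2 : 0 ≤ C * (2 * C + 1) := by positivity
    linarith
  · set n := ⌊j / C⌋₊ with hn
    have hn1 : (1 : ℝ) ≤ n := by exact_mod_cast hpos
    obtain ⟨V, hVf, G, hVn, -, hG⟩ := hA n hpos
    have hle : C * n ≤ j := by
      have := Nat.floor_le (show 0 ≤ (j : ℝ) / C by positivity)
      rw [← hn, le_div_iff₀ hC] at this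
      linarith
    have hge : (j : ℝ) ≤ C * (n + 1) := by
      have := (Nat.lt_floor_add_one ((j : ℝ) / C)).le
      rw [← hn, div_le_iff₀ hC] at this
      linarith
    refine ⟨V, hVf, by exact_mod_cast hVn.trans hle, fun ξ hξ => ?_⟩
    have h1 : A ξ = (A - G ∘L V.orthogonalProjectionOnto) ξ := by
      have : V.orthogonalProjectionOnto ξ = 0 :=
        Submodule.orthogonalProjectionOnto_apply_of_mem_orthogonal hξ
      simp [this]
    rw [h1]
    refine (ContinuousLinearMap.le_opNorm _ _).trans ?_
    gcongr
    refine hG.trans ?_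
    rw [div_le_div_iff₀ (by positivity) hj]
    have h3 : 0 ≤ ‖A‖ * (C + 1) * n := by positivity
    have h4 : (j : ℝ) + 1 ≤ (2 * C + 1) * n := by nlinarith
    have h5 := mul_le_mul_of_nonneg_left h4 hC.le
    linarith

theorem exists_orthonormal_mem_orthogonal {F : ℕ → Submodule ℂ H}
    (hF : ∀ j, FiniteDimensional ℂ (F j)) (hFj : ∀ j, Module.finrank ℂ (F j) ≤ j) (m : ℕ) :
    ∀ U : Submodule ℂ H, FiniteDimensional ℂ U → Module.finrank ℂ U = m →
      ∃ e : Fin m → H, Orthonormal ℂ e ∧ ∀ i, e i ∈ U ∧ e i ∈ (F i)ᗮ := by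
  induction m with
  | zero => exact fun U _ _ => ⟨Fin.elim0, ⟨fun i => i.elim0, fun i => i.elim0⟩, fun i => i.elim0⟩
  | succ m ih =>
    intro U _ hU
    have hker := LinearMap.ker_ne_bot_of_finrank_lt
      (f := ((F m).orthogonalProjectionOnto : H →ₗ[ℂ] F m) ∘ₗ U.subtype)
      (by rw [hU]; exact Nat.lt_succ_of_le (hFj m))
    obtain ⟨u, hu, hu0⟩ := Submodule.exists_mem_ne_zero_of_ne_bot hker
    have huF : (u : H) ∈ (F m)ᗮ :=
      Submodule.orthogonalProjectionOnto_eq_zero_iff.1 hu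
    have hun : ‖(u : H)‖ ≠ 0 := by simpa using hu0
    set w : H := ((‖(u : H)‖⁻¹ : ℝ) : ℂ) • (u : H) with hw
    have hw1 : ‖w‖ = 1 := by
      rw [hw, norm_smul, Complex.norm_real, norm_inv, norm_norm, inv_mul_cancel₀ hun]
    have hwU : w ∈ U := U.smul_mem _ u.2
    have hwF : w ∈ (F m)ᗮ := Submodule.smul_mem _ _ huF
    have hspan : Submodule.span ℂ {w} ≤ U := by simpa using hwU
    have hdim := Submodule.finrank_add_inf_finrank_orthogonal hspan
    rw [finrank_span_singleton (by rw [← norm_ne_zero_iff, hw1]; exact one_ne_zero), hU] at hdim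
    obtain ⟨e, he, heU⟩ := ih ((Submodule.span ℂ {w})ᗮ ⊓ U) inferInstance (by omega)
    have hew : ∀ i, inner ℂ w (e i) = 0 := fun i =>
      Submodule.mem_orthogonal_singleton_iff_inner_right.1 (heU i).1.1
    refine ⟨Fin.snoc e w, ?_, ?_⟩
    · constructor
      · intro i
        refine Fin.lastCases ?_ (fun i => ?_) i
        · simpa using hw1
        · simpa using he.1 i
      · intro i j
        refine Fin.lastCases ?_ (fun i => ?_) i <;> refine Fin.lastCases ?_ (fun j => ?_) j
        · simp
        · intro _; simpa using hew j
        · intro _; simpa using inner_eq_zero_symm.1 (hew i)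
        · intro hij
          simpa using he.2 (fun h => hij (by rw [h]))
    · intro i
      refine Fin.lastCases ?_ (fun i => ?_) i
      · simpa using ⟨hwU, hwF⟩
      · simpa using ⟨(heU i).1.2, (heU i).2⟩

theorem HasLinearDecay.exists_orthonormalBasis {A : H →L[ℂ] H} (hA : HasLinearDecay A) :
    ∃ C : ℝ, 0 < C ∧ ∀ (U : Submodule ℂ H), FiniteDimensional ℂ U →
      ∃ b : OrthonormalBasis (Fin (Module.finrank ℂ U)) ℂ U,
        ∀ i, ‖A (b i)‖ ≤ C / ((i : ℕ) + 1) := by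
  obtain ⟨C, hC, hA⟩ := hA
  choose F hF hFj hFA using hA
  refine ⟨C, hC, fun U _ => ?_⟩
  obtain ⟨e, he, heU⟩ := exists_orthonormal_mem_orthogonal hF hFj _ U inferInstance rfl
  have ho : Orthonormal ℂ (fun i => (⟨e i, (heU i).1⟩ : U)) :=
    ⟨fun i => he.1 i, fun i j hij => he.2 hij⟩
  have hspan : Submodule.span ℂ (Set.range fun i => (⟨e i, (heU i).1⟩ : U)) = ⊤ :=
    ho.linearIndependent.span_eq_top_of_card_eq_finrank' (by simp)
  refine ⟨OrthonormalBasis.mk ho hspan.ge, fun i => ?_⟩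
  rw [OrthonormalBasis.coe_mk]
  have := hFA i _ (heU i).2
  rwa [he.1 i, mul_one] at this

end Approximation

section GeneralizedEigenspaces

theorem Module.End.mem_of_mem_iSup_maxGenEigenspace {M : Type*} [AddCommGroup M] [Module ℂ M]
    {f : Module.End ℂ M} {S : Finset ℂ} {μ : ℂ} {x : M} (hx0 : x ≠ 0)
    (hμ : x ∈ f.maxGenEigenspace μ) (hx : x ∈ ⨆ z ∈ S, f.maxGenEigenspace z) : μ ∈ S := by
  by_contra hS
  refine hx0 (Submodule.disjoint_def.1 (f.independent_maxGenEigenspace μ) x hμ ?_)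
  refine (iSup₂_le fun z hz => ?_ : (⨆ z ∈ S, f.maxGenEigenspace z) ≤ _) hx
  exact le_iSup₂_of_le z (fun h => hS (h ▸ hz)) le_rfl

theorem Module.End.mapsTo_iSup_maxGenEigenspace {M : Type*} [AddCommGroup M] [Module ℂ M]
    (f : Module.End ℂ M) (S : Finset ℂ) :
    Set.MapsTo f (⨆ z ∈ S, f.maxGenEigenspace z : Submodule ℂ M)
      (⨆ z ∈ S, f.maxGenEigenspace z : Submodule ℂ M) :=
  LinearMap.mapsTo_biSup_of_mapsTo (S : Set ℂ) fun z =>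
    f.mapsTo_maxGenEigenspace_of_comm (Commute.refl f) z

theorem Module.End.exists_invariant_of_le_maxGenEigenspace {M : Type*} [AddCommGroup M]
    [Module ℂ M] (f : Module.End ℂ M) (z : ℂ) (W : Submodule ℂ M) (hW : W.FG)
    (hWz : W ≤ f.maxGenEigenspace z) :
    ∃ U : Submodule ℂ M, U.FG ∧ W ≤ U ∧ U ≤ f.maxGenEigenspace z ∧ Set.MapsTo f U U := by
  induction W, hW using Submodule.fg_induction with
  | singleton x =>
    have hx : x ∈ f.maxGenEigenspace z := by simpa using hWz
    obtain ⟨k, hk⟩ := (f.mem_maxGenEigenspace z x).1 hx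
    have hmem : ∀ a : ℕ, ((f - z • 1) ^ a) x ∈
        Submodule.span ℂ (Set.range fun a : Fin k => ((f - z • 1) ^ (a : ℕ)) x) := by
      intro a
      by_cases ha : a < k
      · exact Submodule.subset_span ⟨⟨a, ha⟩, rfl⟩
      · obtain ⟨c, rfl⟩ := Nat.exists_eq_add_of_le (not_lt.1 ha)
        rw [add_comm, pow_add, Module.End.mul_apply, hk, map_zero]
        exact zero_mem _
    refine ⟨_, Submodule.fg_span
      (Set.finite_range fun a : Fin k => ((f - z • 1) ^ (a : ℕ)) x), ?_, ?_, ?_⟩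
    · rw [Submodule.span_singleton_le_iff_mem]
      simpa using hmem 0
    · rw [Submodule.span_le]
      rintro _ ⟨a, rfl⟩
      have hc : Commute f ((f - z • 1) ^ (a : ℕ)) :=
        (((Commute.refl f).sub_right ((Commute.one_right f).smul_right z))).pow_right _
      exact f.mapsTo_maxGenEigenspace_of_comm hc z hx
    · intro y hy
      refine Submodule.span_induction (p := fun y _ => f y ∈ _) ?_ ?_ ?_ ?_ hy
      · rintro _ ⟨a, rfl⟩
        have h := Submodule.add_mem _ (hmem (a + 1)) (Submodule.smul_mem _ z (hmem a))
        rw [pow_succ', Module.End.mul_apply] at h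
        simpa using h
      · simp
      · intro u v _ _ hu hv
        rw [map_add]
        exact Submodule.add_mem _ hu hv
      · intro c u _ hu
        rw [map_smul]
        exact Submodule.smul_mem _ c hu
  | sup W₁ W₂ _ _ h₁ h₂ =>
    obtain ⟨U₁, f₁, l₁, k₁, m₁⟩ := h₁ (le_sup_left.trans hWz)
    obtain ⟨U₂, f₂, l₂, k₂, m₂⟩ := h₂ (le_sup_right.trans hWz)
    refine ⟨U₁ ⊔ U₂, f₁.sup f₂, sup_le_sup l₁ l₂, sup_le k₁ k₂, fun y hy => ?_⟩
    obtain ⟨u, hu, v, hv, rfl⟩ := Submodule.mem_sup.1 hy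
    rw [map_add]
    exact Submodule.add_mem_sup (m₁ hu) (m₂ hv)

theorem Module.End.trace_restrict_iSup_eq_sum {M : Type*} [AddCommGroup M] [Module ℂ M]
    {f : Module.End ℂ M} {S : Finset ℂ}
    (hS : ∀ z ∈ S, FiniteDimensional ℂ (f.maxGenEigenspace z)) (g : Module.End ℂ M)
    (hg : ∀ z, Set.MapsTo g (f.maxGenEigenspace z) (f.maxGenEigenspace z))
    (hg' : Set.MapsTo g (⨆ z ∈ S, f.maxGenEigenspace z : Submodule ℂ M)
      (⨆ z ∈ S, f.maxGenEigenspace z : Submodule ℂ M)) :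
    LinearMap.trace ℂ _ (g.restrict hg') =
      ∑ z ∈ S, LinearMap.trace ℂ _ (g.restrict (hg z)) := by
  have hfin : ∀ i : S, FiniteDimensional ℂ (f.maxGenEigenspace (i : ℂ)) := fun i => hS i i.2
  have hind : iSupIndep fun i : S => f.maxGenEigenspace (i : ℂ) :=
    f.independent_maxGenEigenspace.comp Subtype.val_injective
  have := LinearMap.trace_eq_sum_trace_restrict_of_eq_biSup
    (N := fun i : S => f.maxGenEigenspace (i : ℂ)) Finset.univ
    (hind.comp Subtype.val_injective) (fun i => hg i)
    (⨆ z ∈ S, f.maxGenEigenspace z) (by simp [iSup_subtype]) hg'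
  rw [this]
  exact Finset.sum_coe_sort S fun z => LinearMap.trace ℂ _ (g.restrict (hg z))

theorem Module.End.finiteDimensional_iSup_maxGenEigenspace {M : Type*} [AddCommGroup M]
    [Module ℂ M] (f : Module.End ℂ M) {S : Finset ℂ}
    (hS : ∀ z ∈ S, FiniteDimensional ℂ (f.maxGenEigenspace z)) :
    FiniteDimensional ℂ (⨆ z ∈ S, f.maxGenEigenspace z : Submodule ℂ M) := by
  rw [← Submodule.fg_iff_finiteDimensional]
  exact Submodule.fg_biSup S _ fun z hz => Submodule.fg_iff_finiteDimensional _ |>.2 (hS z hz)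

theorem Module.End.finrank_iSup_maxGenEigenspace {M : Type*} [AddCommGroup M] [Module ℂ M]
    {f : Module.End ℂ M} {S : Finset ℂ}
    (hS : ∀ z ∈ S, FiniteDimensional ℂ (f.maxGenEigenspace z)) :
    Module.finrank ℂ (⨆ z ∈ S, f.maxGenEigenspace z : Submodule ℂ M) =
      ∑ z ∈ S, Module.finrank ℂ (f.maxGenEigenspace z) := by
  have := Module.End.trace_restrict_iSup_eq_sum hS LinearMap.id
    (fun z => Set.mapsTo_id _) (Set.mapsTo_id _)
  have hid : ∀ (p : Submodule ℂ M) [FiniteDimensional ℂ p], LinearMap.trace ℂ p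
      ((LinearMap.id : M →ₗ[ℂ] M).restrict (p := p) (q := p) (Set.mapsTo_id _)) =
        Module.finrank ℂ p := fun p _ => LinearMap.trace_id ℂ p
  have hE : FiniteDimensional ℂ (⨆ z ∈ S, f.maxGenEigenspace z : Submodule ℂ M) :=
    f.finiteDimensional_iSup_maxGenEigenspace hS
  rw [hid] at this
  rw [← Nat.cast_inj (R := ℂ), this, Nat.cast_sum]
  refine Finset.sum_congr rfl fun z hz => ?_
  have := hS z hz
  exact hid _

theorem Module.End.hasEigenvalue_restrict_mem {M : Type*} [AddCommGroup M] [Module ℂ M]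
    {f : Module.End ℂ M} {S : Finset ℂ} {U : Submodule ℂ M} (hf : Set.MapsTo f U U)
    (hU : U ≤ ⨆ z ∈ S, f.maxGenEigenspace z) {μ : ℂ}
    (hμ : Module.End.HasEigenvalue (f.restrict hf) μ) : μ ∈ S := by
  obtain ⟨x, hx⟩ := hμ.exists_hasEigenvector
  refine Module.End.mem_of_mem_iSup_maxGenEigenspace (f := f) (x := x) (by simpa using hx.2) ?_
    (hU x.2)
  exact Module.End.eigenspace_le_maxGenEigenspace
    (Module.End.mem_eigenspace_iff.2 (congrArg Subtype.val hx.apply_eq_smul))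

theorem Module.End.trace_restrict_maxGenEigenspace {M : Type*} [AddCommGroup M] [Module ℂ M]
    (f : Module.End ℂ M) (z : ℂ) [FiniteDimensional ℂ (f.maxGenEigenspace z)]
    (hf : Set.MapsTo f (f.maxGenEigenspace z) (f.maxGenEigenspace z)) :
    LinearMap.trace ℂ _ (f.restrict hf) = Module.finrank ℂ (f.maxGenEigenspace z) * z := by
  have hsp : (LinearMap.charpoly (f.restrict hf)).Splits := IsAlgClosed.splits _
  have hcard : (LinearMap.charpoly (f.restrict hf)).roots.card =
      Module.finrank ℂ (f.maxGenEigenspace z) := by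
    rw [← hsp.natDegree_eq_card_roots, LinearMap.charpoly_natDegree]
  have hroots := Multiset.eq_replicate.2 ⟨hcard, fun μ hμ => by
    have := Module.End.hasEigenvalue_restrict_mem (S := {z}) hf (by simp)
      ((Module.End.hasEigenvalue_iff_isRoot_charpoly _ μ).2 (Polynomial.isRoot_of_mem_roots hμ))
    exact Finset.mem_singleton.1 this⟩
  rw [Module.End.trace_eq_sum_roots_charpoly_of_splits hsp, hroots, Multiset.sum_replicate,
    nsmul_eq_mul]

theorem Module.End.trace_restrict_iSup_maxGenEigenspace {M : Type*} [AddCommGroup M] [Module ℂ M]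
    {f : Module.End ℂ M} {S : Finset ℂ}
    (hS : ∀ z ∈ S, FiniteDimensional ℂ (f.maxGenEigenspace z)) :
    LinearMap.trace ℂ _ (f.restrict (f.mapsTo_iSup_maxGenEigenspace S)) =
      ∑ z ∈ S, Module.finrank ℂ (f.maxGenEigenspace z) * z := by
  rw [Module.End.trace_restrict_iSup_eq_sum hS f
    (fun z => f.mapsTo_maxGenEigenspace_of_comm (Commute.refl f) z)]
  refine Finset.sum_congr rfl fun z hz => ?_
  have := hS z hz
  exact f.trace_restrict_maxGenEigenspace z _

theorem Module.End.pow_finrank_le_norm_det {V : Type*} [AddCommGroup V] [Module ℂ V]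
    [FiniteDimensional ℂ V] (f : Module.End ℂ V) {s : ℝ} (hs : 0 ≤ s)
    (hf : ∀ μ, f.HasEigenvalue μ → s ≤ ‖μ‖) :
    s ^ Module.finrank ℂ V ≤ ‖LinearMap.det f‖ := by
  have hsp : (LinearMap.charpoly f).Splits := IsAlgClosed.splits _
  have hdet := Module.End.det_eq_prod_roots_charpoly_of_splits hsp
  have hcard : (LinearMap.charpoly f).roots.card = Module.finrank ℂ V := by
    rw [← hsp.natDegree_eq_card_roots, LinearMap.charpoly_natDegree]
  rw [hdet, ← hcard]
  have hnn : ∀ R : Multiset ℂ, (∀ μ ∈ R, s ≤ ‖μ‖) → s ^ R.card ≤ ‖R.prod‖ := by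
    intro R
    induction R using Multiset.induction_on with
    | empty => simp
    | cons a R ih =>
      intro h
      rw [Multiset.card_cons, Multiset.prod_cons, norm_mul, pow_succ']
      exact mul_le_mul (h a (by simp)) (ih fun μ hμ => h μ (by simp [hμ])) (by positivity)
        (norm_nonneg _)
  exact hnn _ fun μ hμ => hf μ ((Module.End.hasEigenvalue_iff_isRoot_charpoly _ μ).2
    (Polynomial.isRoot_of_mem_roots hμ))

variable {H : Type u} [NormedAddCommGroup H] [InnerProductSpace ℂ H]

/-- A Weyl-type bound: an invariant subspace on which all eigenvalues have modulus at least `s`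
has dimension `O(1/s)`. -/
theorem HasLinearDecay.exists_mul_finrank_le {A : H →L[ℂ] H} (hA : HasLinearDecay A) :
    ∃ C : ℝ, 0 < C ∧ ∀ (S : Finset ℂ) (s : ℝ), 0 ≤ s → (∀ z ∈ S, s ≤ ‖z‖) →
      ∀ U : Submodule ℂ H, FiniteDimensional ℂ U →
        U ≤ ⨆ z ∈ S, Module.End.maxGenEigenspace (A : H →ₗ[ℂ] H) z →
        Set.MapsTo (A : H →ₗ[ℂ] H) U U → s * Module.finrank ℂ U ≤ C := by
  obtain ⟨C, hC, hb⟩ := hA.exists_orthonormalBasis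
  refine ⟨C * Real.exp 1, by positivity, fun S s hs hsS U _ hUS hAU => ?_⟩
  obtain ⟨b, hb⟩ := hb U inferInstance
  have hdet := Module.End.pow_finrank_le_norm_det ((A : H →ₗ[ℂ] H).restrict hAU) hs fun μ hμ =>
    hsS μ (Module.End.hasEigenvalue_restrict_mem hAU hUS hμ)
  generalize Module.finrank ℂ U = n at b hb hdet ⊢
  rcases Nat.eq_zero_or_pos n with h0 | hpos
  · rw [h0]; simp; positivity
  have h2 := hdet.trans (norm_det_le_prod_norm b _)
  have h3 : s ^ n ≤ C ^ n / n.factorial := by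
    refine h2.trans ((Finset.prod_le_prod (fun _ _ => norm_nonneg _) fun i _ => hb i).trans_eq ?_)
    rw [Fin.prod_univ_eq_prod_range (fun i => C / ((i : ℝ) + 1)) n, Finset.prod_div_distrib,
      Finset.prod_const, Finset.card_range, ← Finset.prod_range_add_one_eq_factorial]
    push_cast
    rfl
  have h4 : (n : ℝ) ^ n / n.factorial ≤ Real.exp n :=
    Real.pow_div_factorial_le_exp _ (Nat.cast_nonneg _) _
  have h5 : (s * n) ^ n ≤ (C * Real.exp 1) ^ n := by
    calc (s * n) ^ n = s ^ n * n ^ n := mul_pow _ _ _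
      _ ≤ C ^ n / n.factorial * n ^ n := by gcongr
      _ = C ^ n * (n ^ n / n.factorial) := by ring
      _ ≤ C ^ n * Real.exp n := by gcongr
      _ = (C * Real.exp 1) ^ n := by rw [mul_pow, ← Real.exp_nat_mul, mul_one]
  exact le_of_pow_le_pow_left₀ hpos.ne' (by positivity) h5

theorem HasLinearDecay.finiteDimensional_maxGenEigenspace {A : H →L[ℂ] H} (hA : HasLinearDecay A)
    {z : ℂ} (hz : z ≠ 0) :
    FiniteDimensional ℂ (Module.End.maxGenEigenspace (A : H →ₗ[ℂ] H) z) := by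
  obtain ⟨C, hC, hA⟩ := hA.exists_mul_finrank_le
  by_contra hinf
  have hz' : 0 < ‖z‖ := norm_pos_iff.2 hz
  obtain ⟨n, hn⟩ := exists_nat_gt (C / ‖z‖)
  rw [div_lt_iff₀' hz'] at hn
  have hr : (n : Cardinal) ≤ Module.rank ℂ (Module.End.maxGenEigenspace (A : H →ₗ[ℂ] H) z) :=
    Cardinal.natCast_lt_aleph0.le.trans (not_lt.1 fun h => hinf (Module.rank_lt_aleph0_iff.1 h))
  obtain ⟨g, hg⟩ := Module.le_rank_iff_exists_linearMap.1 hr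
  set W := LinearMap.range (Submodule.subtype _ ∘ₗ g)
  have hWn : Module.finrank ℂ W = n := by
    rw [LinearMap.finrank_range_of_inj (Subtype.val_injective.comp hg)]; simp
  obtain ⟨U, hUf, hWU, hUz, hAU⟩ := Module.End.exists_invariant_of_le_maxGenEigenspace
    (A : H →ₗ[ℂ] H) z W ((Submodule.fg_iff_finiteDimensional W).2 inferInstance) (by
      rintro _ ⟨x, rfl⟩
      exact (g x).2)
  have hUd := (Submodule.fg_iff_finiteDimensional U).1 hUf
  have h1 := hA {z} ‖z‖ hz'.le (by simp) U hUd (by simpa using hUz) hAU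
  have h2 : (n : ℝ) ≤ Module.finrank ℂ U := by
    rw [← hWn]
    exact_mod_cast Submodule.finrank_mono hWU
  nlinarith

theorem algMult_eq_rank (A : H →L[ℂ] H) (z : ℂ) :
    algMult A z = Module.rank ℂ (Module.End.maxGenEigenspace (A : H →ₗ[ℂ] H) z) := by
  have h : Module.End.maxGenEigenspace (A : H →ₗ[ℂ] H) z =
      ⨆ ℓ : ℕ, LinearMap.ker (((A : H →ₗ[ℂ] H) - z • LinearMap.id) ^ ℓ) := by
    rw [Module.End.maxGenEigenspace, Module.End.genEigenspace_top]
    exact iSup_congr fun k => Module.End.genEigenspace_nat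
  rw [h, algMult]

theorem IsEigenvalueSequence.finrank_maxGenEigenspace {A : H →L[ℂ] H} {lam : ℕ → ℂ}
    (hlam : IsEigenvalueSequence A lam) {z : ℂ} (hz : z ≠ 0) :
    Module.finrank ℂ (Module.End.maxGenEigenspace (A : H →ₗ[ℂ] H) z) =
      Nat.card {j : ℕ // lam j = z} := by
  have := congrArg Cardinal.toNat (hlam.2 z hz)
  rw [Cardinal.toNat_lift, Cardinal.toNat_lift, algMult_eq_rank] at this
  exact this.symm

theorem IsEigenvalueSequence.finite_fiber {A : H →L[ℂ] H} {lam : ℕ → ℂ}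
    (hlam : IsEigenvalueSequence A lam) (hA : HasLinearDecay A) {z : ℂ} (hz : z ≠ 0) :
    Finite {j : ℕ // lam j = z} := by
  have := hA.finiteDimensional_maxGenEigenspace hz
  have h1 := hlam.2 z hz
  rw [algMult_eq_rank] at h1
  rw [← Cardinal.lt_aleph0_iff_finite, ← Cardinal.lift_lt_aleph0, h1,
    Cardinal.lift_lt_aleph0]
  exact Module.rank_lt_aleph0_iff.2 this

theorem IsEigenvalueSequence.exists_norm_mul_le {A : H →L[ℂ] H} {lam : ℕ → ℂ}
    (hlam : IsEigenvalueSequence A lam) (hA : HasLinearDecay A) :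
    ∃ C : ℝ, 0 < C ∧ ∀ j : ℕ, ‖lam j‖ * (j + 1) ≤ C := by
  obtain ⟨C, hC, hb⟩ := hA.exists_mul_finrank_le
  refine ⟨C, hC, fun n => ?_⟩
  rcases eq_or_ne (lam n) 0 with h0 | h0
  · simp [h0, hC.le]
  have hanti : Antitone fun j => ‖lam j‖ := antitone_nat_of_succ_le hlam.1
  set S := (Finset.range (n + 1)).image lam
  have hle : ∀ z ∈ S, ‖lam n‖ ≤ ‖z‖ := by
    intro z hz
    obtain ⟨j, hj, rfl⟩ := Finset.mem_image.1 hz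
    exact hanti (Nat.lt_succ_iff.1 (Finset.mem_range.1 hj))
  have hne : ∀ z ∈ S, z ≠ 0 := fun z hz =>
    norm_pos_iff.1 ((norm_pos_iff.2 h0).trans_le (hle z hz))
  have hfin := fun z hz => hA.finiteDimensional_maxGenEigenspace (hne z hz)
  have h1 := hb S ‖lam n‖ (norm_nonneg _) hle _
    (Module.End.finiteDimensional_iSup_maxGenEigenspace _ hfin) le_rfl
    (Module.End.mapsTo_iSup_maxGenEigenspace _ S)
  refine le_trans ?_ h1
  rw [Module.End.finrank_iSup_maxGenEigenspace hfin]
  gcongr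
  have h2 : n + 1 = ∑ z ∈ S, ((Finset.range (n + 1)).filter fun j => lam j = z).card := by
    rw [← Finset.card_eq_sum_card_image, Finset.card_range]
  have h3 : n + 1 ≤ ∑ z ∈ S,
      Module.finrank ℂ (Module.End.maxGenEigenspace (A : H →ₗ[ℂ] H) z) := by
    rw [h2]
    refine Finset.sum_le_sum fun z hz => ?_
    rw [hlam.finrank_maxGenEigenspace (hne z hz)]
    have := hlam.finite_fiber hA (hne z hz)
    refine (Set.ncard_coe_finset _).symm.trans_le
      (Set.ncard_le_ncard (t := {j | lam j = z}) (fun j hj => ?_) this)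
    simpa using (Finset.mem_filter.1 hj).2
  exact_mod_cast h3

end GeneralizedEigenspaces

section Determinant

variable {H : Type u} [NormedAddCommGroup H] [InnerProductSpace ℂ H]

theorem norm_le_two_mul_of_sub_eq {T : H →L[ℂ] H} (hT : ‖T‖ ≤ 1 / 2) {ξ η : H}
    (h : ξ - T ξ = η) : ‖ξ‖ ≤ 2 * ‖η‖ := by
  have h1 : ‖T ξ‖ ≤ 1 / 2 * ‖ξ‖ := T.le_of_opNorm_le hT ξ
  have h2 : ‖ξ‖ ≤ ‖η‖ + ‖T ξ‖ := by
    rw [← h]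
    simpa using norm_add_le (ξ - T ξ) (T ξ)
  linarith

/-- The perturbation determinant estimate: if `Q (G J + R)` has no eigenvalue of modulus greater
than `1/ρ`, where `J` is the orthogonal projection onto `V`, then `tr (J Q G)` is controlled. -/
theorem norm_trace_le_of_no_eigenvalue [CompleteSpace H] {V : Submodule ℂ H} {m : ℕ}
    (b : OrthonormalBasis (Fin m) ℂ V) [FiniteDimensional ℂ V] (G : V →L[ℂ] H) (Q R : H →L[ℂ] H)
    {ρ a : ℝ} (hρ : 0 < ρ) (ha : 0 < a) (hQ : ‖Q‖ ≤ 1) (hR : ρ * ‖R‖ ≤ 1 / 2)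
    (hG : ∀ i, 1 + 2 * ρ * ‖G (b i)‖ ≤ a / ((i : ℕ) + 1))
    (hev : ∀ μ : ℂ, ρ⁻¹ < ‖μ‖ → ∀ ξ,
      Q (G (V.orthogonalProjectionOnto ξ) + R ξ) = μ • ξ → ξ = 0) :
    ‖LinearMap.trace ℂ V (V.orthogonalProjectionOnto ∘L Q ∘L G : V →L[ℂ] V)‖ ≤ 4 * a / ρ := by
  set J := V.orthogonalProjectionOnto
  set S : ℂ → H →L[ℂ] H := fun z => Ring.inverse (1 - z • (Q * R)) with hS
  have hsmall : ∀ z ∈ Metric.ball (0 : ℂ) ρ, ‖z • (Q * R)‖ ≤ 1 / 2 := by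
    intro z hz
    have hz' : ‖z‖ ≤ ρ := by simpa using (Metric.mem_ball.1 hz).le
    have h1 : ‖Q * R‖ ≤ ‖R‖ := (norm_mul_le _ _).trans
      (mul_le_of_le_one_left (norm_nonneg _) hQ)
    rw [norm_smul]
    exact (mul_le_mul hz' h1 (norm_nonneg _) hρ.le).trans hR
  have hunit : ∀ z ∈ Metric.ball (0 : ℂ) ρ, IsUnit (1 - z • (Q * R)) := fun z hz =>
    isUnit_one_sub_of_norm_lt_one ((hsmall z hz).trans_lt (by norm_num))
  have hSz : ∀ z ∈ Metric.ball (0 : ℂ) ρ, ∀ η, S z η - (z • (Q * R)) (S z η) = η := by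
    intro z hz η
    exact congrArg (fun T : H →L[ℂ] H => T η) (Ring.mul_inverse_cancel _ (hunit z hz))
  have hSd : ∀ z ∈ Metric.ball (0 : ℂ) ρ, DifferentiableAt ℂ S z := by
    intro z hz
    exact DifferentiableAt.comp (f := fun z : ℂ => (1 : H →L[ℂ] H) - z • (Q * R)) z
      (differentiableAt_inverse (hunit z hz)) (by fun_prop)
  set L : ℂ → V →ₗ[ℂ] V := fun z => ((J ∘L S z ∘L Q ∘L G : V →L[ℂ] V) : V →ₗ[ℂ] V) with hL
  set M : ℂ → Matrix (Fin m) (Fin m) ℂ := fun z => LinearMap.toMatrix b.toBasis b.toBasis (L z)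
    with hM
  have hMij : ∀ z i j, M z i j = inner ℂ (b i) (J (S z (Q (G (b j))))) := by
    intro z i j
    change LinearMap.toMatrix b.toBasis b.toBasis (L z) i j = _
    rw [LinearMap.toMatrix_apply, OrthonormalBasis.coe_toBasis_repr_apply,
      OrthonormalBasis.repr_apply_apply, OrthonormalBasis.coe_toBasis]
    rfl
  have hMd : ∀ z ∈ Metric.ball (0 : ℂ) ρ, ∀ i j, DifferentiableAt ℂ (fun z => M z i j) z := by
    intro z hz i j
    simp only [hMij]
    have h1 := ((hSd z hz).clm_apply (differentiableAt_const (Q (G (b j)))))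
    exact ((innerSL ℂ (b i)).differentiableAt).comp z (J.differentiableAt.comp z h1)
  have hdet : ∀ z, (1 - z • M z).det = LinearMap.det (1 - z • L z) := by
    intro z
    rw [← LinearMap.det_toMatrix b.toBasis, map_sub, map_smul]
    simp [hM]
  have h0 : (0 : ℂ) ∈ Metric.ball (0 : ℂ) ρ := Metric.mem_ball_self hρ
  have hS0 : S 0 = 1 := by simp [hS]
  have hder := hasDerivAt_det_one_sub_smul (M := M) fun i j => (hMd 0 h0 i j).continuousAt
  have htr : (M 0).trace = LinearMap.trace ℂ V (J ∘L Q ∘L G : V →L[ℂ] V) := by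
    rw [LinearMap.trace_eq_matrix_trace ℂ b.toBasis, hM]
    simp only [hL, hS0]
    rfl
  have hmain := norm_deriv_zero_le_of_ne_zero (D := fun z => (1 - z • M z).det) hρ ha ?_
    (by simp) ?_ ?_
  · rwa [hder.deriv, norm_neg, htr] at hmain
  · intro z hz
    refine DifferentiableAt.differentiableWithinAt ?_
    simp only [Matrix.det_apply, Matrix.sub_apply, Matrix.smul_apply, smul_eq_mul]
    have := hMd z hz
    fun_prop
  · intro z hz hD
    simp only [hdet] at hD
    obtain ⟨w, hw, hw0⟩ := Submodule.exists_mem_ne_zero_of_ne_bot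
      (LinearMap.det_eq_zero_iff_ker_ne_bot.1 hD)
    have hw1 : w = z • J (S z (Q (G w))) := sub_eq_zero.1 (LinearMap.mem_ker.1 hw)
    have hz0 : z ≠ 0 := by
      rintro rfl
      exact hw0 (by rw [hw1, zero_smul])
    have hξ := hSz z hz (Q (G w))
    set ξ := S z (Q (G w))
    refine hw0 ?_
    rw [hw1, hev z⁻¹ ?_ ξ ?_, map_zero, smul_zero]
    · rw [norm_inv]
      exact inv_strictAnti₀ (norm_pos_iff.2 hz0) (by simpa using hz)
    · rw [eq_inv_smul_iff₀ hz0, map_add, smul_add]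
      have h1 : z • Q (G (J ξ)) = Q (G w) := by
        conv_rhs => rw [hw1]
        simp
      rw [h1, ← hξ]
      simp
  · intro z hz
    simp only [hdet]
    refine (norm_det_le_prod_norm b _).trans ?_
    have hcol : ∀ i, ‖(1 - z • L z) (b i)‖ ≤ a / ((i : ℕ) + 1) := by
      intro i
      refine le_trans ?_ (hG i)
      have h1 : ‖S z (Q (G (b i)))‖ ≤ 2 * ‖G (b i)‖ := by
        refine (norm_le_two_mul_of_sub_eq (hsmall z hz) (hSz z hz _)).trans ?_
        have := Q.le_of_opNorm_le hQ (G (b i))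
        linarith
      have h2 : ‖L z (b i)‖ ≤ 2 * ‖G (b i)‖ :=
        (V.norm_orthogonalProjectionOnto_apply_le _).trans h1
      have hz' : ‖z‖ ≤ ρ := by simpa using (Metric.mem_ball.1 hz).le
      refine (norm_sub_le _ _).trans ?_
      have h3 : ‖(z • L z) (b i)‖ ≤ ρ * (2 * ‖G (b i)‖) := by
        rw [LinearMap.smul_apply, norm_smul]
        exact mul_le_mul hz' h2 (norm_nonneg _) hρ.le
      have h4 : ‖(1 : V →ₗ[ℂ] V) (b i)‖ = 1 := b.norm_eq_one i
      linarith
    refine (Finset.prod_le_prod (fun _ _ => norm_nonneg _) fun i _ => hcol i).trans ?_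
    rw [Fin.prod_univ_eq_prod_range (fun i => a / ((i : ℝ) + 1)) m, Finset.prod_div_distrib,
      Finset.prod_const, Finset.card_range]
    have := Real.pow_div_factorial_le_exp a ha.le m
    rw [← Finset.prod_range_add_one_eq_factorial] at this
    exact_mod_cast this

theorem norm_trace_le_finrank_mul {E : Type*} [NormedAddCommGroup E] [InnerProductSpace ℂ E]
    [FiniteDimensional ℂ E] (T : E →ₗ[ℂ] E) {r : ℝ} (hT : ∀ x, ‖T x‖ ≤ r * ‖x‖) :
    ‖LinearMap.trace ℂ E T‖ ≤ Module.finrank ℂ E * r := by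
  rw [LinearMap.trace_eq_sum_inner T (stdOrthonormalBasis ℂ E)]
  refine (norm_sum_le_of_le _ fun i _ => ?_ : _ ≤ ∑ _i : Fin (Module.finrank ℂ E), r).trans_eq
    (by simp)
  refine (norm_inner_le_norm _ _).trans ?_
  simpa using hT (stdOrthonormalBasis ℂ E i)

/-- Comparison of the trace of `A` on an invariant subspace `E` with the trace of a finite rank
approximant compressed to `Eᗮ`. -/
theorem norm_trace_restrict_add_le {V E : Submodule ℂ H} [FiniteDimensional ℂ V]
    [FiniteDimensional ℂ E] (A : H →L[ℂ] H) (G : V →L[ℂ] H)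
    (htr : LinearMap.trace ℂ V (V.orthogonalProjectionOnto ∘L G : V →L[ℂ] V) = 0)
    (hAE : Set.MapsTo (A : H →ₗ[ℂ] H) E E) :
    ‖LinearMap.trace ℂ E ((A : H →ₗ[ℂ] H).restrict hAE)‖ ≤
      ‖LinearMap.trace ℂ V (V.orthogonalProjectionOnto ∘L (1 - E.starProjection) ∘L G :
          V →L[ℂ] V)‖ +
        Module.finrank ℂ E * ‖A - G ∘L V.orthogonalProjectionOnto‖ := by
  set R := A - G ∘L V.orthogonalProjectionOnto with hR
  set TR : E →ₗ[ℂ] E := ((E.orthogonalProjectionOnto ∘L R ∘L E.subtypeL : E →L[ℂ] E) : E →ₗ[ℂ] E)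
  have h1 : LinearMap.trace ℂ V (V.orthogonalProjectionOnto ∘L (1 - E.starProjection) ∘L G :
      V →L[ℂ] V) = -LinearMap.trace ℂ V
        (((V.orthogonalProjectionOnto : H →ₗ[ℂ] V) ∘ₗ E.subtype) ∘ₗ
          ((E.orthogonalProjectionOnto : H →ₗ[ℂ] E) ∘ₗ (G : V →ₗ[ℂ] H))) := by
    rw [← zero_sub, ← htr, ← map_sub]
    congr 1
    ext x
    simp
  have h2 : (A : H →ₗ[ℂ] H).restrict hAE =
      ((E.orthogonalProjectionOnto : H →ₗ[ℂ] E) ∘ₗ (G : V →ₗ[ℂ] H)) ∘ₗ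
        ((V.orthogonalProjectionOnto : H →ₗ[ℂ] V) ∘ₗ E.subtype) + TR := by
    refine LinearMap.ext fun x => ?_
    have h3 : E.orthogonalProjectionOnto (A x) = (A : H →ₗ[ℂ] H).restrict hAE x :=
      E.orthogonalProjectionOnto_mem_subspace_eq_self ((A : H →ₗ[ℂ] H).restrict hAE x)
    rw [← h3]
    simp [TR, hR]
  rw [h2, map_add, h1, norm_neg, LinearMap.trace_comp_comm']
  refine (norm_add_le _ _).trans (add_le_add le_rfl ?_)
  refine norm_trace_le_finrank_mul _ fun x => ?_
  exact (E.norm_orthogonalProjectionOnto_apply_le _).trans (R.le_opNorm _)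

theorem Module.End.iSup_maxGenEigenspace_le_map_sup {M : Type*} [AddCommGroup M] [Module ℂ M]
    {f : Module.End ℂ M} {S : Finset ℂ}
    (hS : ∀ z ∈ S, FiniteDimensional ℂ (f.maxGenEigenspace z)) (μ : ℂ) :
    (⨆ z ∈ S, f.maxGenEigenspace z) ≤
      (⨆ z ∈ S, f.maxGenEigenspace z).map (f - μ • 1) ⊔ f.maxGenEigenspace μ := by
  refine iSup₂_le fun z hz => ?_
  rcases eq_or_ne z μ with rfl | hzμ
  · exact le_sup_right
  refine le_sup_of_le_left (le_trans (fun x hx => ?_) (Submodule.map_mono (le_iSup₂ z hz)))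
  have := hS z hz
  have hmaps : Set.MapsTo (f - μ • 1 : Module.End ℂ M) (f.maxGenEigenspace z)
      (f.maxGenEigenspace z) := f.mapsTo_maxGenEigenspace_of_comm
    ((Commute.refl f).sub_right ((Commute.one_right f).smul_right μ)) z
  have hinj : Function.Injective ((f - μ • 1 : Module.End ℂ M).restrict hmaps) := by
    rw [← LinearMap.ker_eq_bot, LinearMap.ker_eq_bot']
    intro y hy
    by_contra hy0
    have hyμ : (y : M) ∈ f.maxGenEigenspace μ :=
      (f.mem_maxGenEigenspace μ _).2 ⟨1, by
        rw [pow_one]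
        exact congrArg Subtype.val hy⟩
    exact hzμ (Finset.mem_singleton.1 (Module.End.mem_of_mem_iSup_maxGenEigenspace (S := {z})
      (by simpa using hy0) hyμ (by simp))).symm
  obtain ⟨y, hy⟩ := (LinearMap.injective_iff_surjective.1 hinj) ⟨x, hx⟩
  exact ⟨y, y.2, congrArg Subtype.val hy⟩

/-- Compressing `A` to the complement of a sum of generalized eigenspaces removes the
corresponding eigenvalues. -/
theorem eq_zero_of_compression_eigenvector {A : H →L[ℂ] H} {S : Finset ℂ} {E : Submodule ℂ H}
    [FiniteDimensional ℂ E]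
    (hE : E = ⨆ z ∈ S, Module.End.maxGenEigenspace (A : H →ₗ[ℂ] H) z)
    {μ : ℂ} (hμ0 : μ ≠ 0) (hμ : Module.End.maxGenEigenspace (A : H →ₗ[ℂ] H) μ ≤ E) {ξ : H}
    (hξ : (1 - E.starProjection) (A ξ) = μ • ξ) : ξ = 0 := by
  have hξo : ξ ∈ Eᗮ := by
    rw [← Submodule.smul_mem_iff _ hμ0, ← hξ]
    exact E.sub_starProjection_mem_orthogonal _
  have hfin : ∀ z ∈ S, FiniteDimensional ℂ (Module.End.maxGenEigenspace (A : H →ₗ[ℂ] H) z) :=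
    fun z hz => Submodule.finiteDimensional_of_le ((le_iSup₂ z hz).trans hE.ge)
  have hmem : A ξ - μ • ξ ∈ E := by
    rw [← hξ]
    simp
  have hle := Module.End.iSup_maxGenEigenspace_le_map_sup hfin μ
  rw [← hE] at hle
  obtain ⟨_, ⟨y, hy, rfl⟩, v, hv, hyv⟩ := Submodule.mem_sup.1 (hle hmem)
  have h1 : ((A : H →ₗ[ℂ] H) - μ • 1) (ξ - y) = v := by
    rw [map_sub, sub_eq_iff_eq_add']
    exact hyv.symm
  have h2 : ξ - y ∈ Module.End.maxGenEigenspace (A : H →ₗ[ℂ] H) μ := by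
    obtain ⟨k, hk⟩ := (Module.End.mem_maxGenEigenspace _ _ _).1 hv
    refine (Module.End.mem_maxGenEigenspace _ _ _).2 ⟨k + 1, ?_⟩
    rw [pow_succ, Module.End.mul_apply, h1, hk]
  have h3 : ξ ∈ E := by simpa using E.add_mem (hμ h2) hy
  exact Submodule.disjoint_def.1 E.orthogonal_disjoint ξ h3 hξo

theorem HasTracelessApprox.exists_norm_trace_le [CompleteSpace H] {A : H →L[ℂ] H}
    (hA : HasTracelessApprox A) {κ : ℝ} (hκ : 0 < κ) :
    ∃ C : ℝ, 0 < C ∧ ∀ (n : ℕ), 1 ≤ n → ∀ (S : Finset ℂ) (E : Submodule ℂ H)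
      (_ : FiniteDimensional ℂ E) (hAE : Set.MapsTo (A : H →ₗ[ℂ] H) E E),
      (E = ⨆ z ∈ S, Module.End.maxGenEigenspace (A : H →ₗ[ℂ] H) z) →
      (∀ μ : ℂ, κ / n < ‖μ‖ → Module.End.maxGenEigenspace (A : H →ₗ[ℂ] H) μ ≤ E) →
      Module.finrank ℂ E ≤ n →
      ‖LinearMap.trace ℂ E ((A : H →ₗ[ℂ] H).restrict hAE)‖ ≤ C := by
  obtain ⟨C₀, hC₀, hb⟩ := hA.hasLinearDecay.exists_orthonormalBasis
  obtain ⟨C₁, hC₁, hA⟩ := hA.exists_submodule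
  set c : ℝ := min κ⁻¹ (2 * C₁)⁻¹
  have hc0 : 0 < c := by positivity
  have hcκ : c ≤ κ⁻¹ := min_le_left _ _
  have hcC : c * C₁ ≤ 1 / 2 := by
    have := mul_le_mul_of_nonneg_right (min_le_right κ⁻¹ (2 * C₁)⁻¹) hC₁.le
    refine this.trans_eq ?_
    field_simp
  set α : ℝ := 2 * C₁ + 2 * c * C₀ with hα
  have hα0 : 0 < α := by positivity
  refine ⟨4 * α / c + C₁, by positivity, fun n hn S E _ hAE hE hμ hEn => ?_⟩
  have hn0 : (0 : ℝ) < n := by exact_mod_cast hn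
  obtain ⟨V, _, G, hVn, htr, hR⟩ := hA n hn
  obtain ⟨b, hb⟩ := hb V inferInstance
  set R := A - G ∘L V.orthogonalProjectionOnto with hRd
  have hAR : ∀ ξ, G (V.orthogonalProjectionOnto ξ) + R ξ = A ξ := fun ξ => by simp [hRd]
  have h1 := norm_trace_le_of_no_eigenvalue b G (1 - E.starProjection) R (ρ := c * n)
    (a := α * n) (by positivity) (by positivity) ?_ ?_ ?_ ?_
  · refine (norm_trace_restrict_add_le A G htr hAE).trans (add_le_add (h1.trans_eq ?_) ?_)
    · field_simp
    · calc (Module.finrank ℂ E : ℝ) * ‖R‖ ≤ n * (C₁ / n) := by gcongr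
        _ = C₁ := by field_simp
  · refine ContinuousLinearMap.opNorm_le_bound _ zero_le_one fun ξ => ?_
    rw [one_mul]
    have : (1 - E.starProjection) ξ = Eᗮ.starProjection ξ := by
      rw [E.starProjection_orthogonal_val]; rfl
    rw [this]
    exact Submodule.norm_starProjection_apply_le _ _
  · calc c * n * ‖R‖ ≤ c * n * (C₁ / n) := by gcongr
      _ = c * C₁ := by field_simp
      _ ≤ 1 / 2 := hcC
  · intro i
    have hi : ((i : ℕ) : ℝ) + 1 ≤ C₁ * n := le_trans (by exact_mod_cast i.2) hVn
    have hGb : ‖G (b i)‖ ≤ C₀ / ((i : ℕ) + 1) + C₁ / n := by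
      have h2 := hAR (b i)
      rw [V.orthogonalProjectionOnto_mem_subspace_eq_self] at h2
      rw [eq_sub_of_add_eq h2]
      refine (norm_sub_le _ _).trans (add_le_add (hb i) ((R.le_opNorm _).trans ?_))
      have hbi : ‖(b i : H)‖ = 1 := b.norm_eq_one i
      rwa [hbi, mul_one]
    calc 1 + 2 * (c * n) * ‖G (b i)‖
        ≤ 1 + 2 * (c * n) * (C₀ / ((i : ℕ) + 1) + C₁ / n) := by gcongr
      _ = ((1 + 2 * (c * C₁)) * ((i : ℕ) + 1) + 2 * c * C₀ * n) / ((i : ℕ) + 1) := by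
        field_simp
        ring
      _ ≤ ((1 + 2 * (1 / 2)) * (C₁ * n) + 2 * c * C₀ * n) / ((i : ℕ) + 1) := by gcongr
      _ = α * n / ((i : ℕ) + 1) := by rw [hα]; ring
  · intro μ hμn ξ hξ
    rw [hAR] at hξ
    have hκn : κ / n ≤ (c * n)⁻¹ := by
      rw [mul_inv, div_eq_mul_inv]
      gcongr
      exact le_inv_of_le_inv₀ hc0 hcκ
    have hμ0 : μ ≠ 0 := by
      rw [← norm_pos_iff]
      exact lt_trans (by positivity) hμn
    exact eq_zero_of_compression_eigenvector hE hμ0 (hμ μ (hκn.trans_lt hμn)) hξ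

theorem exists_norm_sum_range_le {lam : ℕ → ℂ} {κ : ℝ}
    (hlam : ∀ j : ℕ, ‖lam j‖ * (j + 1) ≤ κ) (hanti : Antitone fun j => ‖lam j‖) {N : ℕ}
    (hN : 1 ≤ N) :
    ∃ M ≤ N, (∀ j, κ / N < ‖lam j‖ ↔ j < M) ∧
      ‖∑ j ∈ Finset.range N, lam j‖ ≤ ‖∑ j ∈ Finset.range M, lam j‖ + κ := by
  classical
  have hN0 : (0 : ℝ) < N := by exact_mod_cast hN
  have hκ : 0 ≤ κ := le_trans (by positivity) (hlam 0)
  have hlast : ‖lam (N - 1)‖ ≤ κ / N := by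
    have h := hlam (N - 1)
    rw [Nat.cast_sub hN, Nat.cast_one, sub_add_cancel] at h
    rwa [le_div_iff₀ hN0]
  have hex : ∃ j, ‖lam j‖ ≤ κ / N := ⟨_, hlast⟩
  have hiff : ∀ j, κ / N < ‖lam j‖ ↔ j < Nat.find hex := by
    intro j
    rw [Nat.lt_find_iff]
    exact ⟨fun h i hi => not_le.2 (h.trans_le (hanti hi)), fun h => not_le.1 (h j le_rfl)⟩
  have hMN : Nat.find hex ≤ N := (Nat.find_le hlast).trans (Nat.sub_le _ _)
  refine ⟨Nat.find hex, hMN, hiff, ?_⟩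
  rw [← Finset.sum_range_add_sum_Ico _ hMN]
  refine (norm_add_le _ _).trans (add_le_add le_rfl ?_)
  refine (norm_sum_le_of_le _ fun j hj => ?_ :
    _ ≤ ∑ _j ∈ Finset.Ico (Nat.find hex) N, κ / N).trans ?_
  · exact not_lt.1 fun h => not_lt.2 (Finset.mem_Ico.1 hj).1 ((hiff j).1 h)
  · rw [Finset.sum_const, Nat.card_Ico, nsmul_eq_mul]
    calc ((N - Nat.find hex : ℕ) : ℝ) * (κ / N) ≤ N * (κ / N) := by
          gcongr
          exact Nat.sub_le _ _
      _ = κ := by field_simp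

end Determinant

/-- If `A ∈ Com(𝓛_{1,∞})` on a separable Hilbert space, then the partial sums
`∑_{j<N} λ_j(A)` of any eigenvalue sequence of `A` are bounded. -/
theorem commutator_eigenvalue_sums_bounded {H : Type u} [NormedAddCommGroup H]
    [InnerProductSpace ℂ H] [CompleteSpace H] [TopologicalSpace.SeparableSpace H]
    (A : H →L[ℂ] H) (hA : A ∈ ComL1inf H)
    (lamA : ℕ → ℂ) (hlA : IsEigenvalueSequence A lamA) :
    ∃ C : ℝ, ∀ N : ℕ, 1 ≤ N → ‖∑ j ∈ Finset.range N, lamA j‖ ≤ C := by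
  have hT := HasTracelessApprox.of_mem_comL1inf hA
  have hD := hT.hasLinearDecay
  obtain ⟨κ, hκ, hlam⟩ := hlA.exists_norm_mul_le hD
  obtain ⟨C, hC, htr⟩ := hT.exists_norm_trace_le hκ
  refine ⟨C + κ, fun N hN => ?_⟩
  have hN0 : (0 : ℝ) < N := by exact_mod_cast hN
  obtain ⟨M, hMN, hM, hsum⟩ :=
    exists_norm_sum_range_le hlam (antitone_nat_of_succ_le hlA.1) hN
  refine hsum.trans (add_le_add ?_ le_rfl)
  have hne : ∀ z : ℂ, κ / N < ‖z‖ → z ≠ 0 := fun z hz =>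
    norm_pos_iff.1 (lt_trans (by positivity) hz)
  have hfr : ∀ z : ℂ, κ / N < ‖z‖ →
      Module.finrank ℂ (Module.End.maxGenEigenspace (A : H →ₗ[ℂ] H) z) =
        ((Finset.range M).filter fun j => lamA j = z).card := by
    intro z hz
    rw [hlA.finrank_maxGenEigenspace (hne z hz)]
    refine Nat.subtype_card _ fun j => ?_
    rw [Finset.mem_filter, Finset.mem_range, and_iff_right_iff_imp]
    rintro rfl
    exact (hM j).1 hz
  set S := (Finset.range M).image lamA
  have hSz : ∀ z ∈ S, κ / N < ‖z‖ := by
    intro z hz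
    obtain ⟨j, hj, rfl⟩ := Finset.mem_image.1 hz
    exact (hM j).2 (Finset.mem_range.1 hj)
  have hfin := fun z hz => hD.finiteDimensional_maxGenEigenspace (hne z (hSz z hz))
  have h := htr N hN S _ (Module.End.finiteDimensional_iSup_maxGenEigenspace _ hfin)
    (Module.End.mapsTo_iSup_maxGenEigenspace _ S) rfl ?_ ?_
  · rw [Module.End.trace_restrict_iSup_maxGenEigenspace hfin] at h
    have hcomp : ∑ j ∈ Finset.range M, lamA j =
        ∑ z ∈ S, (Module.finrank ℂ (Module.End.maxGenEigenspace (A : H →ₗ[ℂ] H) z) : ℂ) * z := by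
      rw [Finset.sum_comp (fun z => z) lamA]
      refine Finset.sum_congr rfl fun z hz => ?_
      rw [hfr z (hSz z hz), nsmul_eq_mul]
    rwa [hcomp]
  · intro μ hμ
    by_cases hμS : μ ∈ S
    · exact le_iSup₂ (f := fun z _ => Module.End.maxGenEigenspace (A : H →ₗ[ℂ] H) z) μ hμS
    · have := hD.finiteDimensional_maxGenEigenspace (hne μ hμ)
      have h0 : Module.finrank ℂ (Module.End.maxGenEigenspace (A : H →ₗ[ℂ] H) μ) = 0 := by
        rw [hfr μ hμ, Finset.card_eq_zero, Finset.filter_eq_empty_iff]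
        exact fun j hj hjμ => hμS (Finset.mem_image.2 ⟨j, hj, hjμ⟩)
      rw [Submodule.finrank_eq_zero.1 h0]
      exact bot_le
  · rw [Module.End.finrank_iSup_maxGenEigenspace hfin,
      Finset.sum_congr rfl fun z hz => hfr z (hSz z hz), ← Finset.card_eq_sum_card_image,
      Finset.card_range]
    exact hMN
end
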